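/- Let f and g be transcendental entire functions, and let L be any straight line in the complex plane, i.e., L = {a + t·b : t ∈ ℝ} for some a, b ∈ ℂ with b ≠ 0. Then f ∘ g has infinitely many fixed points not lying on L; that is, the set {z ∈ ℂ : f(g(z)) = z and z ∉ L} is infinite. -/

import Mathlib

section
open Metric Set Filter Topology

/-- spherical derivative -/
noncomputable def sph (f : ℂ → ℂ) (z : ℂ) : ℝ := ‖deriv f z‖ / (1 + ‖f z‖ ^ 2)

lemma sph_nonneg (f : ℂ → ℂ) (z : ℂ) : 0 ≤ sph f z := by
  unfold sph; positivity

lemma lip_sph {f : ℂ → ℂ} {c : ℂ} {r K : ℝ} (hf : DifferentiableOn ℂ f (ball c r))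
    (hK : ∀ z ∈ ball c r, sph f z ≤ K) {x y : ℂ} (hx : x ∈ ball c r) (hy : y ∈ ball c r) :
    |1 / (1 + ‖f y‖ ^ 2) - 1 / (1 + ‖f x‖ ^ 2)| ≤ K * ‖y - x‖ := by
  have key : ∀ z ∈ ball c r, ∃ L : ℂ →L[ℝ] ℝ,
      HasFDerivAt (fun z => (1 + ‖f z‖ ^ 2)⁻¹) L z ∧ ‖L‖ ≤ K := by
    intro z hz
    have hd : HasDerivAt f (deriv f z) z :=
      (hf.differentiableAt (isOpen_ball.mem_nhds hz)).hasDerivAt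
    have h1 := (hd.hasFDerivAt.restrictScalars ℝ)
    have h2 := h1.norm_sq
    have h3 := h2.const_add 1
    have hpos : (0 : ℝ) < 1 + ‖f z‖ ^ 2 := by positivity
    have h4 := (hasDerivAt_inv hpos.ne').comp_hasFDerivAt z h3
    refine ⟨_, h4, ?_⟩
    refine ContinuousLinearMap.opNorm_le_bound _ ((sph_nonneg f z).trans (hK z hz)) ?_
    intro v
    refine le_trans ?_ (mul_le_mul_of_nonneg_right (hK z hz) (norm_nonneg v))
    simp only [_root_.smul_apply, ContinuousLinearMap.comp_apply, innerSL_apply_apply,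
      ContinuousLinearMap.coe_restrictScalars', smul_eq_mul, norm_mul]
    have h5 : ‖(inner ℝ (f z) ((ContinuousLinearMap.toSpanSingleton ℂ (deriv f z)) v) : ℝ)‖
        ≤ ‖f z‖ * (‖v‖ * ‖deriv f z‖) := by
      refine (norm_inner_le_norm _ _).trans ?_
      simp
    have h6 : ‖(2 • (inner ℝ (f z) ((ContinuousLinearMap.toSpanSingleton ℂ (deriv f z)) v) : ℝ))‖
        ≤ 2 * (‖f z‖ * (‖v‖ * ‖deriv f z‖)) := by
      rw [nsmul_eq_mul, norm_mul]
      simpa using h5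
    unfold sph
    rw [norm_neg, norm_inv, norm_pow, Real.norm_of_nonneg hpos.le]
    refine (mul_le_mul_of_nonneg_left h6 (by positivity)).trans ?_
    have : ((1 + ‖f z‖ ^ 2) ^ 2)⁻¹ * (2 * (‖f z‖ * (‖v‖ * ‖deriv f z‖)))
      = (2 * ‖f z‖) / (1 + ‖f z‖ ^ 2) * (‖deriv f z‖ / (1 + ‖f z‖ ^ 2) * ‖v‖) := by
      field_simp
    rw [this]
    have h7 : (2 * ‖f z‖) / (1 + ‖f z‖ ^ 2) ≤ 1 := by
      rw [div_le_one hpos]; nlinarith [sq_nonneg (‖f z‖ - 1)]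
    exact mul_le_of_le_one_left (by positivity) h7
  choose! L hL hLK using key
  have := (convex_ball c r).norm_image_sub_le_of_norm_hasFDerivWithin_le
    (fun z hz => (hL z hz).hasFDerivWithinAt) hLK hx hy
  simpa [Real.norm_eq_abs] using this

lemma exists_log_ball {F : ℂ → ℂ} {u : ℂ} {c : ℝ} (hF : DifferentiableOn ℂ F (ball u c))
    (h0 : ∀ z ∈ ball u c, F z ≠ 0) :
    ∃ G : ℂ → ℂ, DifferentiableOn ℂ G (ball u c) ∧ ∀ z ∈ ball u c, Complex.exp (G z) = F z := by
  rcases le_or_gt c 0 with hc | hc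
  · refine ⟨fun _ => 0, by fun_prop, ?_⟩
    rw [ball_eq_empty.2 hc]; simp
  have hd : DifferentiableOn ℂ (fun z => deriv F z / F z) (ball u c) :=
    (hF.deriv isOpen_ball).div hF h0
  obtain ⟨G, hG⟩ := hd.isExactOn_ball
  have hu : u ∈ ball u c := mem_ball_self hc
  let G1 := fun z => G z - G u + Complex.log (F u)
  have hG1 : ∀ z ∈ ball u c, HasDerivAt G1 (deriv F z / F z) z := fun z hz =>
    ((hG z hz).sub_const _).add_const _
  refine ⟨G1, fun z hz => (hG1 z hz).differentiableAt.differentiableWithinAt, ?_⟩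
  have hconst : ∀ z ∈ ball u c, HasDerivAt (fun z => F z * Complex.exp (-G1 z)) 0 z := by
    intro z hz
    have h1 : HasDerivAt F (deriv F z) z :=
      (hF.differentiableAt (isOpen_ball.mem_nhds hz)).hasDerivAt
    have h2 := h1.mul (hG1 z hz).neg.cexp
    convert! h2 using 1
    have := h0 z hz
    field_simp
    ring
  intro z hz
  have h3 : F z * Complex.exp (-G1 z) = F u * Complex.exp (-G1 u) := by
    apply isOpen_ball.is_const_of_deriv_eq_zero (convex_ball u c).isPreconnected
      (fun w hw => (hconst w hw).differentiableAt.differentiableWithinAt)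
      (fun w hw => (hconst w hw).deriv) hz hu
  have h4 : F u * Complex.exp (-G1 u) = 1 := by
    simp [G1, Complex.exp_neg, Complex.exp_log (h0 u hu), h0 u hu]
  rw [h4, Complex.exp_neg] at h3
  have := Complex.exp_ne_zero (G1 z)
  field_simp at h3
  exact h3.symm

lemma harnack_re {G : ℂ → ℂ} {u v : ℂ} {c : ℝ} (hG : DifferentiableOn ℂ G (ball u c))
    (hpos : ∀ z ∈ ball u c, 0 < (G z).re) (hc : 0 < c) (hv : ‖v - u‖ ≤ c / 2) :
    (G v).re ≤ 3 * (G u).re ∧ (G u).re ≤ 3 * (G v).re := by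
  have hu : u ∈ ball u c := mem_ball_self hc
  have hvb : v ∈ ball u c := by rw [mem_ball_iff_norm]; linarith
  have hne : ∀ z ∈ ball u c, G z + (starRingEnd ℂ) (G u) ≠ 0 := by
    intro z hz h
    have := congrArg Complex.re h
    simp at this
    linarith [hpos z hz, hpos u hu]
  let S := fun z => (G z - G u) / (G z + (starRingEnd ℂ) (G u))
  have hS : DifferentiableOn ℂ S (ball u c) :=
    (hG.sub_const _).div (hG.add_const _) hne
  have hmaps : MapsTo S (ball u c) (ball (S u) 1) := by
    intro z hz
    have : S u = 0 := by simp [S]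
    rw [this, mem_ball_zero_iff]
    simp only [S, norm_div]
    rw [div_lt_one (norm_pos_iff.2 (hne z hz))]
    rw [Complex.norm_def, Complex.norm_def]
    apply Real.sqrt_lt_sqrt (Complex.normSq_nonneg _)
    simp [Complex.normSq_apply]
    nlinarith [hpos z hz, hpos u hu, mul_pos (hpos z hz) (hpos u hu)]
  have h1 := Complex.dist_le_div_mul_dist_of_mapsTo_ball hS (hmaps.mono_right ball_subset_closedBall) hvb
  have h2 : ‖S v‖ ≤ 1 / 2 := by
    have : S u = 0 := by simp [S]
    rw [this, dist_zero_right, dist_eq_norm] at h1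
    refine h1.trans ?_
    calc 1 / c * ‖v - u‖ ≤ 1 / c * (c / 2) := by gcongr
      _ = 1 / 2 := by field_simp
  simp only [S, norm_div] at h2
  rw [div_le_iff₀ (norm_pos_iff.2 (hne v hvb))] at h2
  have h3 : ‖G v - G u‖ ^ 2 ≤ (1 / 2 * ‖G v + (starRingEnd ℂ) (G u)‖) ^ 2 := by gcongr
  rw [mul_pow, ← Complex.normSq_eq_norm_sq, ← Complex.normSq_eq_norm_sq] at h3
  simp [Complex.normSq_apply] at h3
  have p1 := hpos v hvb
  have p2 := hpos u hu
  have h4 : ((G v).re - (G u).re) ^ 2 ≤ (((G v).re + (G u).re) / 2) ^ 2 := by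
    nlinarith [sq_nonneg ((G v).im - (G u).im)]
  have h5 := abs_le_of_sq_le_sq h4 (by linarith)
  have := abs_le.1 h5
  constructor <;> nlinarith

lemma harnack {F : ℂ → ℂ} {u v : ℂ} {c : ℝ} (hF : DifferentiableOn ℂ F (ball u c))
    (h1 : ∀ z ∈ ball u c, 1 ≤ ‖F z‖) (hc : 0 < c) (hv : ‖v - u‖ ≤ c / 2) :
    ‖F v‖ ≤ ‖F u‖ ^ 3 ∧ ‖F u‖ ≤ ‖F v‖ ^ 3 := by
  have h0 : ∀ z ∈ ball u c, F z ≠ 0 := fun z hz h => by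
    have := h1 z hz; rw [h] at this; norm_num at this
  obtain ⟨G, hG, hE⟩ := exists_log_ball hF h0
  have hu : u ∈ ball u c := mem_ball_self hc
  have hvb : v ∈ ball u c := by rw [mem_ball_iff_norm]; linarith
  have hre : ∀ z ∈ ball u c, 0 ≤ (G z).re := by
    intro z hz
    have := h1 z hz
    rw [← hE z hz, Complex.norm_exp] at this
    exact Real.one_le_exp_iff.1 this |>.trans' le_rfl
  have key : ∀ ε > 0, (G v).re ≤ 3 * (G u).re + ε ∧ (G u).re ≤ 3 * (G v).re + ε := by
    intro ε hε
    have := harnack_re (G := fun z => G z + ((ε / 3 : ℝ) : ℂ)) (hG.add_const _)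
      (fun z hz => by
        have := hre z hz
        rw [Complex.add_re, Complex.ofReal_re]; positivity) hc hv
    simp only [Complex.add_re, Complex.ofReal_re] at this
    constructor <;> linarith [this.1, this.2]
  have k1 : (G v).re ≤ 3 * (G u).re := le_of_forall_pos_le_add fun ε hε => (key ε hε).1
  have k2 : (G u).re ≤ 3 * (G v).re := le_of_forall_pos_le_add fun ε hε => (key ε hε).2
  rw [← hE u hu, ← hE v hvb, Complex.norm_exp, Complex.norm_exp, ← Real.exp_nat_mul,
    ← Real.exp_nat_mul]
  exact ⟨Real.exp_le_exp.2 (by simpa using k1), Real.exp_le_exp.2 (by simpa using k2)⟩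



lemma st_step {f : ℂ → ℂ} {u v : ℂ} {r K A : ℝ} (hf : DifferentiableOn ℂ f (ball u r))
    (hK : ∀ z ∈ ball u r, sph f z ≤ K) (hr : 0 < r) (hKr : K * r ≤ 1 / 10) (hA : 3 ≤ A)
    (hu : ‖f u‖ ≤ A) (hv : ‖v - u‖ ≤ r / 2) : ‖f v‖ ≤ A ^ 3 := by
  have hub : u ∈ ball u r := mem_ball_self hr
  have hvb : v ∈ ball u r := by rw [mem_ball_iff_norm]; linarith
  have hK0 : 0 ≤ K := (sph_nonneg f u).trans (hK u hub)
  have hL : ∀ w ∈ ball u r, |1 / (1 + ‖f w‖ ^ 2) - 1 / (1 + ‖f u‖ ^ 2)| ≤ 1 / 10 := by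
    intro w hw
    refine (lip_sph hf hK hub hw).trans (le_trans ?_ hKr)
    rw [mem_ball_iff_norm] at hw
    gcongr
  rcases le_or_gt ‖f u‖ 2 with h2 | h2
  · have h3 : 1 / 5 ≤ 1 / (1 + ‖f u‖ ^ 2) := by
      apply one_div_le_one_div_of_le (by positivity); nlinarith [norm_nonneg (f u)]
    have h4 := (abs_le.1 (hL v hvb)).1
    have h5 : 1 / 10 ≤ 1 / (1 + ‖f v‖ ^ 2) := by linarith
    have h6 : 1 + ‖f v‖ ^ 2 ≤ 10 := le_of_one_div_le_one_div (by norm_num) h5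
    have h7 : ‖f v‖ ≤ 3 := by nlinarith [norm_nonneg (f v)]
    have : A ≤ A ^ 3 := le_self_pow₀ (by linarith) (by norm_num)
    linarith
  · have h1 : ∀ w ∈ ball u r, 1 ≤ ‖f w‖ := by
      intro w hw
      have h3 : 1 / (1 + ‖f u‖ ^ 2) ≤ 1 / 5 := by
        apply one_div_le_one_div_of_le (by positivity); nlinarith [norm_nonneg (f u)]
      have h4 := (abs_le.1 (hL w hw)).2
      have h5 : 1 / (1 + ‖f w‖ ^ 2) ≤ 1 / 2 := by linarith
      have h6 : 2 ≤ 1 + ‖f w‖ ^ 2 := le_of_one_div_le_one_div (by positivity) h5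
      nlinarith [norm_nonneg (f w)]
    exact (harnack hf h1 hr hv).1.trans (by gcongr)

lemma sph_continuousOn {f : ℂ → ℂ} {U : Set ℂ} (hU : IsOpen U) (hf : DifferentiableOn ℂ f U) :
    ContinuousOn (sph f) U := by
  unfold sph
  refine ContinuousOn.div (hf.deriv hU).continuousOn.norm ?_ (fun z _ => by positivity)
  exact continuousOn_const.add (hf.continuousOn.norm.pow 2)

lemma sph_comp_affine (f : ℂ → ℂ) (p : ℂ) (ρ : ℝ) (hρ : 0 ≤ ρ) (u : ℂ) :
    sph (fun u => f (p + ρ * u)) u = ρ * sph f (p + ρ * u) := by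
  unfold sph
  have h1 : deriv (fun u => f (p + ρ * u)) u = ρ * deriv f (p + ρ * u) := by
    have := deriv_comp_mul_left (ρ : ℂ) (fun u => f (p + u)) u
    rw [this, deriv_comp_const_add]; simp
  rw [h1, norm_mul, Complex.norm_real, Real.norm_of_nonneg hρ, mul_div_assoc]

lemma zalcman {f : ℂ → ℂ} {U : Set ℂ} {c : ℂ} {δ : ℝ} (hU : IsOpen U)
    (hf : DifferentiableOn ℂ f U) (hsub : closedBall c δ ⊆ U) (hδ : 0 < δ) (hpos : 0 < sph f c) :
    ∃ (p : ℂ) (ρ M : ℝ), 0 < ρ ∧ δ * sph f c ≤ M ∧ sph (fun u => f (p + ρ * u)) 0 = 1 ∧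
      ∀ u : ℂ, ‖u‖ ≤ M / 2 → p + ρ * u ∈ ball c δ ∧ sph (fun u => f (p + ρ * u)) u ≤ 2 := by
  have hc : ContinuousOn (fun w => (δ - ‖w - c‖) * sph f w) (closedBall c δ) :=
    ((continuous_const.sub (continuous_id.sub continuous_const).norm).continuousOn).mul
      ((sph_continuousOn hU hf).mono hsub)
  obtain ⟨p, hp, hmax⟩ := (isCompact_closedBall c δ).exists_isMaxOn
    ⟨c, mem_closedBall_self hδ.le⟩ hc
  set M := (δ - ‖p - c‖) * sph f p with hM
  have hM1 : δ * sph f c ≤ M := by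
    have := hmax (mem_closedBall_self hδ.le)
    simpa using this
  have hM0 : 0 < M := lt_of_lt_of_le (by positivity) hM1
  have hp' : ‖p - c‖ ≤ δ := by simpa [dist_eq_norm] using hp
  have hsp : 0 < sph f p := by
    rcases (sph_nonneg f p).lt_or_eq with h | h
    · exact h
    · rw [hM, ← h] at hM0; simp at hM0
  have hd : 0 < δ - ‖p - c‖ := by
    by_contra h
    have : M ≤ 0 := mul_nonpos_of_nonpos_of_nonneg (not_lt.1 h) hsp.le
    linarith
  refine ⟨p, 1 / sph f p, M, by positivity, hM1, ?_, ?_⟩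
  · rw [sph_comp_affine _ _ _ (by positivity)]
    simp; field_simp
  · intro u hu
    have h1 : ‖((1 / sph f p : ℝ) : ℂ) * u‖ ≤ (δ - ‖p - c‖) / 2 := by
      rw [norm_mul, Complex.norm_real, Real.norm_of_nonneg (by positivity)]
      calc 1 / sph f p * ‖u‖ ≤ 1 / sph f p * (M / 2) := by gcongr
        _ = _ := by rw [hM]; field_simp
    set w := p + ((1 / sph f p : ℝ) : ℂ) * u with hw
    have h2 : ‖w - c‖ ≤ ‖p - c‖ + (δ - ‖p - c‖) / 2 := by
      have : w - c = (p - c) + ((1 / sph f p : ℝ) : ℂ) * u := by rw [hw]; ring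
      rw [this]; exact (norm_add_le _ _).trans (by gcongr)
    have hwb : w ∈ ball c δ := by rw [mem_ball_iff_norm]; linarith
    refine ⟨hwb, ?_⟩
    rw [sph_comp_affine _ _ _ (by positivity)]
    have h3 : (δ - ‖w - c‖) * sph f w ≤ M := hmax (ball_subset_closedBall hwb)
    have h4 : (δ - ‖p - c‖) / 2 * sph f w ≤ (δ - ‖p - c‖) * sph f p :=
      le_trans (mul_le_mul_of_nonneg_right (by linarith) (sph_nonneg f w)) h3
    have h5 : sph f w ≤ 2 * sph f p := by
      have : (δ - ‖p - c‖) * sph f w ≤ (δ - ‖p - c‖) * (2 * sph f p) := by linarith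
      exact le_of_mul_le_mul_left this hd
    rw [← hw, one_div, inv_mul_le_iff₀ hsp]; linarith

lemma center_bound {F : ℂ → ℂ} (hF : DifferentiableOn ℂ F (ball 0 1))
    (h2 : ∀ u ∈ ball (0 : ℂ) 1, sph F u ≤ 2) (h1 : sph F 0 = 1) : ‖F 0‖ ≤ 41 ^ 3 := by
  by_contra hcon
  push Not at hcon
  have hsub : ball (0 : ℂ) (1 / 20) ⊆ ball 0 1 := ball_subset_ball (by norm_num)
  have hge : ∀ w ∈ ball (0 : ℂ) (1 / 20), 1 ≤ ‖F w‖ := by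
    intro w hw
    have h3 : 1 / (1 + ‖F 0‖ ^ 2) ≤ 1 / 5 := by
      apply one_div_le_one_div_of_le (by positivity); nlinarith [norm_nonneg (F 0)]
    have h4 := (abs_le.1 (lip_sph hF h2 (mem_ball_self one_pos) (hsub hw))).2
    have hw' : ‖w - 0‖ < 1 / 20 := by simpa using hw
    have h5 : 1 / (1 + ‖F w‖ ^ 2) ≤ 1 / 2 := by linarith
    have h6 : 2 ≤ 1 + ‖F w‖ ^ 2 := le_of_one_div_le_one_div (by positivity) h5
    nlinarith [norm_nonneg (F w)]
  have hF' := hF.mono hsub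
  have hH := fun v (hv : ‖v - 0‖ ≤ 1 / 20 / 2) => (harnack hF' hge (by norm_num) hv).2
  have hne : ∀ w ∈ ball (0 : ℂ) (1 / 20), F w ≠ 0 := fun w hw h => by
    have := hge w hw; rw [h] at this; norm_num at this
  have hinv : DifferentiableOn ℂ (fun z => (F z)⁻¹) (ball 0 (1 / 20)) := hF'.inv hne
  have hc : ‖deriv (fun z => (F z)⁻¹) 0‖ ≤ (1 / 41) / (1 / 40) := by
    apply Complex.norm_deriv_le_of_forall_mem_sphere_norm_le (by norm_num)
    · apply DifferentiableOn.diffContOnCl_ball (U := ball 0 (1 / 20)) hinv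
      apply closedBall_subset_ball; norm_num
    · intro z hz
      have hz' : ‖z - 0‖ = 1 / 40 := by simpa using hz
      have h7 := hH z (by rw [hz']; norm_num)
      have h8 : 41 < ‖F z‖ := lt_of_pow_lt_pow_left₀ 3 (norm_nonneg _) (hcon.trans_le h7)
      rw [norm_inv, one_div]
      exact inv_anti₀ (by norm_num) h8.le
  have hd0 : DifferentiableAt ℂ F 0 :=
    hF.differentiableAt (isOpen_ball.mem_nhds (mem_ball_self one_pos))
  have h00 := hne 0 (mem_ball_self (by norm_num))
  rw [deriv_fun_inv'' hd0 h00, norm_div, norm_neg, norm_pow] at hc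
  unfold sph at h1
  rw [div_eq_one_iff_eq (by positivity)] at h1
  rw [h1, div_le_iff₀ (by positivity)] at hc
  nlinarith [norm_nonneg (F 0)]

lemma chain_bound {f : ℂ → ℂ} {R A : ℝ} (hf : DifferentiableOn ℂ f (ball 0 R))
    (h2 : ∀ u ∈ ball (0 : ℂ) R, sph f u ≤ 2) (hA : 3 ≤ A) (h0 : ‖f 0‖ ≤ A) (k : ℕ) :
    ∀ u : ℂ, ‖u‖ ≤ k / 40 → ((k : ℝ) + 2) / 40 ≤ R → ‖f u‖ ≤ A ^ (3 ^ k) := by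
  induction k with
  | zero =>
    intro u hu _
    have : u = 0 := by simpa using hu
    simpa [this] using h0
  | succ k ih =>
    intro u hu hR
    push_cast at hu hR
    set u' : ℂ := ((k / (k + 1) : ℝ) : ℂ) * u with hu'
    have hn1 : ‖u'‖ ≤ k / 40 := by
      rw [hu', norm_mul, Complex.norm_real, Real.norm_of_nonneg (by positivity)]
      calc (k : ℝ) / (k + 1) * ‖u‖ ≤ k / (k + 1) * ((k + 1) / 40) := by gcongr
        _ = _ := by field_simp
    have hn2 : ‖u - u'‖ ≤ 1 / 20 / 2 := by
      have : u - u' = ((1 / (k + 1) : ℝ) : ℂ) * u := by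
        rw [hu']; push_cast
        have : (k : ℂ) + 1 ≠ 0 := by exact_mod_cast Nat.succ_ne_zero k
        field_simp; ring
      rw [this, norm_mul, Complex.norm_real, Real.norm_of_nonneg (by positivity)]
      calc (1 : ℝ) / (k + 1) * ‖u‖ ≤ 1 / (k + 1) * ((k + 1) / 40) := by gcongr
        _ = _ := by field_simp; norm_num
    have hsub : ball u' (1 / 20) ⊆ ball 0 R := by
      apply ball_subset_ball'
      rw [dist_zero_right]; linarith
    have := st_step (hf.mono hsub) (fun z hz => h2 z (hsub hz)) (by norm_num) (by norm_num)
      (hA.trans (le_self_pow₀ (by linarith) (by positivity))) (ih u' hn1 (by linarith)) hn2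
    rwa [← pow_mul, ← pow_succ] at this



lemma lip_of_bdd {f : ℂ → ℂ} {x y : ℂ} {ε C : ℝ} (hf : DifferentiableOn ℂ f (ball x ε))
    (hC : ∀ u ∈ ball x ε, ‖f u‖ ≤ C) (hy : y ∈ ball x ε) : ‖f y - f x‖ ≤ 2 * C / ε * ‖y - x‖ := by
  have hε : 0 < ε := pos_of_mem_ball hy
  have hm : MapsTo f (ball x ε) (closedBall (f x) (2 * C)) := by
    intro z hz
    rw [mem_closedBall_iff_norm]
    refine (norm_sub_le _ _).trans ?_
    linarith [hC z hz, hC x (mem_ball_self hε)]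
  simpa [dist_eq_norm] using Complex.dist_le_div_mul_dist_of_mapsTo_ball hf hm hy

/-- Montel along an ultrafilter. -/
lemma ultra_montel {ι : Type*} (l : Ultrafilter ι) (F : ι → ℂ → ℂ)
    (h : ∀ x : ℂ, ∃ ε > 0, ∃ C : ℝ, ∀ᶠ n in (l : Filter ι), DifferentiableOn ℂ (F n) (ball x ε) ∧
      ∀ u ∈ ball x ε, ‖F n u‖ ≤ C) :
    ∃ H : ℂ → ℂ, TendstoLocallyUniformly F H (l : Filter ι) := by
  have hpt : ∀ x, ∃ y, Tendsto (fun n => F n x) (l : Filter ι) (𝓝 y) := by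
    intro x
    obtain ⟨ε, hε, C, hC⟩ := h x
    have hmem : ∀ᶠ n in (l : Filter ι), F n x ∈ closedBall (0 : ℂ) C := by
      filter_upwards [hC] with n hn
      simpa using hn.2 x (mem_ball_self hε)
    obtain ⟨y, -, hy⟩ := (isCompact_closedBall (0 : ℂ) C).ultrafilter_le_nhds
      (l.map (fun n => F n x)) (le_principal_iff.2 hmem)
    exact ⟨y, hy⟩
  choose H hH using hpt
  refine ⟨H, ?_⟩
  rw [Metric.tendstoLocallyUniformly_iff]
  intro η hη x
  obtain ⟨ε, hε, C, hC⟩ := h x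
  set L := max (2 * C / ε) 1 with hL
  have hLpos : 0 < L := lt_of_lt_of_le one_pos (le_max_right _ _)
  refine ⟨ball x (min ε (η / 4 / L)), ball_mem_nhds _ (by positivity), ?_⟩
  have hl : ∀ y ∈ ball x (min ε (η / 4 / L)), ∀ᶠ n in (l : Filter ι), ‖F n y - F n x‖ ≤ η / 4 := by
    intro y hy
    filter_upwards [hC] with n hn
    have hy1 : y ∈ ball x ε := ball_subset_ball (min_le_left _ _) hy
    refine (lip_of_bdd hn.1 hn.2 hy1).trans ?_
    have hy2 : ‖y - x‖ ≤ η / 4 / L := by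
      have := mem_ball_iff_norm.1 hy
      exact this.le.trans (min_le_right _ _)
    calc 2 * C / ε * ‖y - x‖ ≤ L * (η / 4 / L) := by
          gcongr
          exact le_max_left _ _
      _ = η / 4 := by field_simp
  have hx : ∀ᶠ n in (l : Filter ι), dist (F n x) (H x) < η / 4 :=
    (Metric.tendsto_nhds.1 (hH x)) _ (by positivity)
  have hlH : ∀ y ∈ ball x (min ε (η / 4 / L)), ‖H y - H x‖ ≤ η / 4 := by
    intro y hy
    exact le_of_tendsto ((hH y).sub (hH x)).norm (hl y hy)
  filter_upwards [hC, hx] with n hn hxn y hy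
  have hy1 : y ∈ ball x ε := ball_subset_ball (min_le_left _ _) hy
  have h1 : ‖F n y - F n x‖ ≤ η / 4 := by
    refine (lip_of_bdd hn.1 hn.2 hy1).trans ?_
    have hy2 : ‖y - x‖ ≤ η / 4 / L := by
      have := mem_ball_iff_norm.1 hy
      exact this.le.trans (min_le_right _ _)
    calc 2 * C / ε * ‖y - x‖ ≤ L * (η / 4 / L) := by
          gcongr
          exact le_max_left _ _
      _ = η / 4 := by field_simp
  have h2 := hlH y hy
  rw [dist_eq_norm] at hxn ⊢
  have : H y - F n y = (H y - H x) - (F n x - H x) - (F n y - F n x) := by ring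
  rw [this]
  have h3 := norm_sub_le ((H y - H x) - (F n x - H x)) (F n y - F n x)
  have h4 := norm_sub_le (H y - H x) (F n x - H x)
  linarith

lemma ultralimit {ι : Type*} (l : Ultrafilter ι) (F : ι → ℂ → ℂ) (R : ι → ℝ)
    (hR : Tendsto R (l : Filter ι) atTop)
    (hF : ∀ᶠ n in (l : Filter ι), DifferentiableOn ℂ (F n) (ball 0 (R n)))
    (h2 : ∀ᶠ n in (l : Filter ι), ∀ u ∈ ball (0 : ℂ) (R n), sph (F n) u ≤ 2)
    (h0 : ∀ᶠ n in (l : Filter ι), sph (F n) 0 = 1) :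
    ∃ H : ℂ → ℂ, Differentiable ℂ H ∧ sph H 0 = 1 ∧ TendstoLocallyUniformly F H (l : Filter ι) := by
  have hhol : ∀ r : ℝ, ∀ᶠ n in (l : Filter ι), DifferentiableOn ℂ (F n) (ball 0 r) := by
    intro r
    filter_upwards [hF, hR.eventually_ge_atTop r] with n hn hr
    exact hn.mono (ball_subset_ball hr)
  have hb : ∀ k : ℕ, ∃ C : ℝ, ∀ᶠ n in (l : Filter ι), ∀ u : ℂ, ‖u‖ ≤ (k : ℝ) / 40 → ‖F n u‖ ≤ C := by
    intro k
    refine ⟨(41 ^ 3 : ℝ) ^ (3 ^ k), ?_⟩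
    filter_upwards [hF, h2, h0, hR.eventually_ge_atTop 1,
      hR.eventually_ge_atTop (((k : ℝ) + 2) / 40)] with n hn h2n h0n hr1 hr2 u hu
    have hs := ball_subset_ball (x := (0 : ℂ)) hr1
    have := center_bound (hn.mono hs) (fun u hu => h2n u (hs hu)) h0n
    exact chain_bound hn h2n (by norm_num) this k u hu hr2
  obtain ⟨H, hH⟩ := ultra_montel l F (by
    intro x
    obtain ⟨k, hk⟩ := exists_nat_ge ((‖x‖ + 1) * 40)
    obtain ⟨C, hC⟩ := hb k
    have hk' : ‖x‖ + 1 ≤ (k : ℝ) / 40 := by linarith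
    refine ⟨1, one_pos, C, ?_⟩
    have hsub : ∀ u ∈ ball x 1, ‖u‖ < ‖x‖ + 1 := by
      intro u hu
      have := mem_ball_iff_norm.1 hu
      have := norm_le_norm_add_norm_sub' u x
      linarith
    filter_upwards [hC, hhol (‖x‖ + 1)] with n hn hd
    refine ⟨hd.mono ?_, ?_⟩
    · intro u hu; simpa using hsub u hu
    · intro u hu
      exact hn u (by linarith [hsub u hu]))
  have hHd : Differentiable ℂ H := by
    intro x
    have h1 : TendstoLocallyUniformlyOn F H (l : Filter ι) (ball 0 (‖x‖ + 1)) :=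
      hH.tendstoLocallyUniformlyOn
    have := h1.differentiableOn (hhol _) isOpen_ball
    exact this.differentiableAt (isOpen_ball.mem_nhds (by simp))
  refine ⟨H, hHd, ?_, hH⟩
  have h1 : TendstoLocallyUniformlyOn F H (l : Filter ι) (ball 0 1) :=
    hH.tendstoLocallyUniformlyOn
  have hm : (0 : ℂ) ∈ ball (0 : ℂ) 1 := mem_ball_self one_pos
  have hd := (h1.deriv (hhol _) isOpen_ball).tendsto_at hm
  have hv := h1.tendsto_at hm
  have hs : Tendsto (fun n => sph (F n) 0) (l : Filter ι) (𝓝 (sph H 0)) := by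
    unfold sph
    exact hd.norm.div (tendsto_const_nhds.add (hv.norm.pow 2)) (by positivity)
  have hs1 : Tendsto (fun n => sph (F n) 0) (l : Filter ι) (𝓝 1) :=
    (tendsto_congr' (h0.mono fun n hn => hn)).2 tendsto_const_nhds
  exact tendsto_nhds_unique hs hs1

/-- Hurwitz -/
lemma hurwitz {ι : Type*} (l : Filter ι) (F : ι → ℂ → ℂ) (H : ℂ → ℂ) (hH : Differentiable ℂ H)
    (hlim : TendstoLocallyUniformly F H l) (hnc : ∃ a b, H a ≠ H b) (u : ℂ) {ε : ℝ} (hε : 0 < ε)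
    (hF : ∀ᶠ n in l, DifferentiableOn ℂ (F n) (ball u ε)) :
    ∀ᶠ n in l, ∃ v ∈ ball u ε, F n v = H u := by
  have hA : AnalyticOnNhd ℂ H univ := hH.differentiableOn.analyticOnNhd isOpen_univ
  have hev : ∀ᶠ z in 𝓝[≠] u, H z ≠ H u := by
    rcases (hA u (mem_univ _)).eventually_eq_or_eventually_ne (analyticAt_const (v := H u)) with h | h
    · exfalso
      have := hA.eqOn_of_preconnected_of_eventuallyEq analyticOnNhd_const isPreconnected_univ
        (mem_univ u) h
      obtain ⟨a, b, hab⟩ := hnc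
      exact hab ((this (mem_univ a)).trans (this (mem_univ b)).symm)
    · exact h
  rw [eventually_nhdsWithin_iff, Metric.eventually_nhds_iff] at hev
  obtain ⟨r₀, hr₀, hr⟩ := hev
  set r := min r₀ ε / 2 with hrdef
  have hrpos : 0 < r := by positivity
  have hrr₀ : r < r₀ := by have := min_le_left r₀ ε; rw [hrdef]; linarith
  have hrε : r < ε := by have := min_le_right r₀ ε; rw [hrdef]; linarith
  have hsph : ∀ z ∈ sphere u r, H z ≠ H u := by
    intro z hz
    have : dist z u = r := hz
    apply hr (by linarith)
    intro h
    rw [mem_singleton_iff] at h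
    rw [h, dist_self] at this; linarith
  obtain ⟨z₁, hz₁, hmin⟩ := (isCompact_sphere u r).exists_isMinOn (NormedSpace.sphere_nonempty.2 hrpos.le)
    (f := fun z => ‖H z - H u‖) (hH.continuous.sub continuous_const).norm.continuousOn
  set m := ‖H z₁ - H u‖ with hm
  have hmpos : 0 < m := norm_pos_iff.2 (sub_ne_zero.2 (hsph z₁ hz₁))
  have hunif : TendstoUniformlyOn F H l (closedBall u r) :=
    (tendstoLocallyUniformlyOn_iff_tendstoUniformlyOn_of_compact (isCompact_closedBall u r)).1
      hlim.tendstoLocallyUniformlyOn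
  have he := Metric.tendstoUniformlyOn_iff.1 hunif (m / 8) (by positivity)
  filter_upwards [he, hF] with n hn hd
  have hn' : ∀ z ∈ closedBall u r, ‖H z - F n z‖ < m / 8 := fun z hz => by
    simpa [dist_eq_norm] using hn z hz
  have hud := hn' u (mem_closedBall_self hrpos.le)
  have hge : ∀ z ∈ sphere u r, m / 2 ≤ ‖F n z - F n u‖ := by
    intro z hz
    have h1 := hn' z (sphere_subset_closedBall hz)
    have h2 : m ≤ ‖H z - H u‖ := hmin hz
    have h3 : H z - H u = (H z - F n z) + (F n z - F n u) - (H u - F n u) := by ring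
    have h4 := norm_sub_le ((H z - F n z) + (F n z - F n u)) (H u - F n u)
    have h5 := norm_add_le (H z - F n z) (F n z - F n u)
    rw [← h3] at h4
    linarith
  have hcl : closedBall u r ⊆ ball u ε := closedBall_subset_ball hrε
  have hdc : DiffContOnCl ℂ (F n) (ball u r) := hd.diffContOnCl_ball hcl
  have hfr : ∃ᶠ z in 𝓝 u, F n z ≠ F n u := by
    by_contra hno
    rw [not_frequently] at hno
    have hE : F n =ᶠ[𝓝 u] fun _ => F n u := hno.mono fun z hz => not_not.1 hz
    have hAn : AnalyticOnNhd ℂ (F n) (ball u ε) := hd.analyticOnNhd isOpen_ball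
    have := hAn.eqOn_of_preconnected_of_eventuallyEq analyticOnNhd_const
      (convex_ball u ε).isPreconnected (mem_ball_self hε) hE
    have h6 := hge z₁ hz₁
    rw [this (hcl (sphere_subset_closedBall hz₁))] at h6
    simp at h6; linarith
  obtain ⟨v, hv, hve⟩ := hdc.ball_subset_image_closedBall hrpos hge hfr
    (show H u ∈ ball (F n u) (m / 2 / 2) by rw [mem_ball_iff_norm]; linarith)
  exact ⟨v, hcl hv, hve⟩

lemma nonconst_of_sph {H : ℂ → ℂ} (h : sph H 0 = 1) : ∃ a b, H a ≠ H b := by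
  by_contra hcon
  push Not at hcon
  have : H = fun _ => H 0 := funext fun z => hcon z 0
  unfold sph at h
  rw [this] at h
  simp at h


lemma sph_pow_le {f h : ℂ → ℂ} {m : ℕ} {c : ℝ} (hc : 0 < c) (hh : DifferentiableOn ℂ h (ball 0 c))
    (hf : ∀ z ∈ ball (0 : ℂ) c, h z ^ m = f z) : sph f 0 ≤ 2 * m * sph h 0 := by
  rcases Nat.eq_zero_or_pos m with rfl | hm
  · have : f =ᶠ[𝓝 0] fun _ => 1 := by
      filter_upwards [ball_mem_nhds (0 : ℂ) hc] with z hz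
      simpa using (hf z hz).symm
    simp [sph, this.deriv_eq]
  have h0 : (0 : ℂ) ∈ ball (0 : ℂ) c := mem_ball_self hc
  have hE : f =ᶠ[𝓝 0] fun z => h z ^ m := by
    filter_upwards [ball_mem_nhds (0 : ℂ) hc] with z hz
    exact (hf z hz).symm
  have hd : DifferentiableAt ℂ h 0 := hh.differentiableAt (isOpen_ball.mem_nhds h0)
  unfold sph
  rw [hE.deriv_eq, hE.eq_of_nhds, deriv_fun_pow hd]
  simp only [norm_mul, norm_pow, RCLike.norm_natCast]
  set t := ‖h 0‖ with ht
  have ht0 : 0 ≤ t := norm_nonneg _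
  have key : t ^ (m - 1) * (1 + t ^ 2) ≤ 2 * (1 + (t ^ m) ^ 2) := by
    obtain ⟨k, rfl⟩ : ∃ k, m = k + 1 := ⟨m - 1, by omega⟩
    simp only [Nat.add_sub_cancel]
    have e1 : t ^ k ≤ 1 + (t ^ (k + 1)) ^ 2 := by
      rcases le_total t 1 with h | h
      · have : t ^ k ≤ 1 := pow_le_one₀ ht0 h
        nlinarith [sq_nonneg (t ^ (k + 1))]
      · have : t ^ k ≤ t ^ ((k + 1) * 2) := pow_le_pow_right₀ h (by omega)
        rw [pow_mul] at this; linarith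
    have e2 : t ^ k * t ^ 2 ≤ 1 + (t ^ (k + 1)) ^ 2 := by
      rw [← pow_add]
      rcases le_total t 1 with h | h
      · have : t ^ (k + 2) ≤ 1 := pow_le_one₀ ht0 h
        nlinarith [sq_nonneg (t ^ (k + 1))]
      · have : t ^ (k + 2) ≤ t ^ ((k + 1) * 2) := pow_le_pow_right₀ h (by omega)
        rw [pow_mul] at this; linarith
    linarith
  rw [div_le_iff₀ (by positivity)]
  have : 2 * (m : ℝ) * (‖deriv h 0‖ / (1 + t ^ 2)) * (1 + (t ^ m) ^ 2)
     = (m * ‖deriv h 0‖ / (1 + t ^ 2)) * (2 * (1 + (t ^ m) ^ 2)) := by ring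
  rw [this]
  refine le_trans ?_ (mul_le_mul_of_nonneg_left key (by positivity))
  apply le_of_eq
  have : (1 + t ^ 2) ≠ 0 := by positivity
  field_simp

lemma dyadic_root_dense (ζ : ℂ) (hζ : ‖ζ‖ = 1) {s : Set ℂ} (hs : s ∈ 𝓝 ζ) :
    ∃ ξ ∈ s, ∃ m : ℕ, ξ ^ (2 ^ m) = 1 := by
  obtain ⟨θ, hθ⟩ : ∃ θ : ℝ, Complex.exp (θ * Complex.I) = ζ := by
    refine ⟨Complex.arg ζ, ?_⟩
    have := Complex.norm_mul_exp_arg_mul_I ζ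
    rwa [hζ, Complex.ofReal_one, one_mul] at this
  set x := θ / (2 * Real.pi) with hx
  have hpi := Real.pi_pos
  have ht : Tendsto (fun m : ℕ => ((⌊x * 2 ^ m⌋ : ℤ) : ℝ) / 2 ^ m) atTop (𝓝 x) := by
    have h1 : Tendsto (fun m : ℕ => ((1 : ℝ) / 2) ^ m) atTop (𝓝 0) :=
      tendsto_pow_atTop_nhds_zero_of_lt_one (by norm_num) (by norm_num)
    have h2 : Tendsto (fun m : ℕ => x - ((1 : ℝ) / 2) ^ m) atTop (𝓝 x) := by
      simpa using tendsto_const_nhds.sub h1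
    refine tendsto_of_tendsto_of_tendsto_of_le_of_le h2 tendsto_const_nhds ?_ ?_
    · intro m
      have := Int.lt_floor_add_one (x * 2 ^ m)
      have hp : (0 : ℝ) < 2 ^ m := by positivity
      simp only
      rw [le_div_iff₀ hp, sub_mul, one_div, inv_pow, inv_mul_cancel₀ hp.ne']
      linarith
    · intro m
      have := Int.floor_le (x * 2 ^ m)
      have hp : (0 : ℝ) < 2 ^ m := by positivity
      simp only
      rw [div_le_iff₀ hp]; exact this
  have hcont : Continuous fun y : ℝ => Complex.exp ((2 * Real.pi * y : ℝ) * Complex.I) := by fun_prop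
  have hlim := (hcont.tendsto x).comp ht
  have hxζ : Complex.exp ((2 * Real.pi * x : ℝ) * Complex.I) = ζ := by
    rw [← hθ, hx]; congr 3; field_simp
  rw [hxζ] at hlim
  obtain ⟨m, hm⟩ := (hlim.eventually hs).exists
  refine ⟨_, hm, m, ?_⟩
  simp only [Function.comp]
  rw [← Complex.exp_nat_mul, Complex.exp_eq_one_iff]
  refine ⟨⌊x * 2 ^ m⌋, ?_⟩
  push_cast
  have : (2 : ℂ) ^ m ≠ 0 := pow_ne_zero _ two_ne_zero
  field_simp

/-- an entire function avoiding the unit circle is constant -/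
lemma const_of_avoid_circle {H : ℂ → ℂ} (hH : Differentiable ℂ H) (h : ∀ z, ‖H z‖ ≠ 1)
    (a b : ℂ) : H a = H b := by
  by_cases hex : ∃ a, ‖H a‖ < 1
  · have hall : ∀ z, ‖H z‖ < 1 := by
      intro z
      by_contra hz
      obtain ⟨a, ha⟩ := hex
      obtain ⟨w, hw⟩ := mem_range_of_exists_le_of_exists_ge (c := 1) hH.continuous.norm
        ⟨a, ha.le⟩ ⟨z, not_lt.1 hz⟩
      exact h w hw
    apply hH.apply_eq_apply_of_bounded
    rw [isBounded_iff_forall_norm_le]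
    exact ⟨1, by rintro _ ⟨z, rfl⟩; exact (hall z).le⟩
  · push Not at hex
    have hne : ∀ z, H z ≠ 0 := fun z hz => by
      have := hex z; rw [hz] at this; norm_num at this
    have hd : Differentiable ℂ fun z => (H z)⁻¹ := hH.inv hne
    have := hd.apply_eq_apply_of_bounded (by
      rw [isBounded_iff_forall_norm_le]
      refine ⟨1, ?_⟩
      rintro _ ⟨z, rfl⟩
      simp only [norm_inv]
      exact inv_le_one_of_one_le₀ (hex z)) a b
    exact inv_injective this

lemma montel_const : ∃ K : ℝ, 1 ≤ K ∧ ∀ f : ℂ → ℂ, DifferentiableOn ℂ f (ball 0 1) →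
    (∀ z ∈ ball (0 : ℂ) 1, f z ≠ 0 ∧ f z ≠ 1) → sph f 0 ≤ K := by
  by_contra hcon
  push Not at hcon
  have hN : ∀ N : ℕ, ∃ h : ℂ → ℂ, DifferentiableOn ℂ h (ball 0 1) ∧
      (∀ z ∈ ball (0 : ℂ) 1, h z ^ (2 ^ N) ≠ 1) ∧ (N + 1 : ℝ) ≤ sph h 0 := by
    intro N
    obtain ⟨f, hfd, hf, hs⟩ := hcon (2 * ((2 ^ N : ℕ) : ℝ) * (N + 1)) (by
      have : (1 : ℝ) ≤ ((2 ^ N : ℕ) : ℝ) := by exact_mod_cast Nat.one_le_two_pow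
      have : (0 : ℝ) ≤ N := Nat.cast_nonneg N
      nlinarith)
    obtain ⟨G, hG, hE⟩ := exists_log_ball hfd (fun z hz => (hf z hz).1)
    have hp : ∀ z ∈ ball (0 : ℂ) 1, Complex.exp (G z / ((2 ^ N : ℕ) : ℂ)) ^ (2 ^ N) = f z := by
      intro z hz
      rw [← Complex.exp_nat_mul, mul_div_cancel₀, hE z hz]
      exact_mod_cast (pow_pos two_pos N).ne'
    have hd : DifferentiableOn ℂ (fun z => Complex.exp (G z / ((2 ^ N : ℕ) : ℂ))) (ball 0 1) :=
      (hG.div_const _).cexp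
    refine ⟨_, hd, fun z hz => by rw [hp z hz]; exact (hf z hz).2, ?_⟩
    have h1 := sph_pow_le one_pos hd hp
    have h2 := hs.trans_le h1
    have h3 : (0 : ℝ) < 2 * ((2 ^ N : ℕ) : ℝ) := by positivity
    exact (lt_of_mul_lt_mul_left h2 h3.le).le
  choose h hd ho hs using hN
  have hz := fun N => zalcman isOpen_ball (hd N) (closedBall_subset_ball (by norm_num : (1 / 2 : ℝ) < 1))
    (by norm_num) (lt_of_lt_of_le (by positivity) (hs N))
  choose p ρ M hρ hM h1 h2 using hz
  set l : Ultrafilter ℕ := hyperfilter ℕ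
  have hl : (l : Filter ℕ) ≤ atTop := by rw [← Nat.cofinite_eq_atTop]; exact hyperfilter_le_cofinite
  have hR : Tendsto (fun N => M N / 2) (l : Filter ℕ) atTop := by
    apply Tendsto.mono_left _ hl
    apply tendsto_atTop_mono (f := fun N : ℕ => (N : ℝ) / 4)
    · intro N
      have := hM N; have := hs N; linarith
    · exact tendsto_natCast_atTop_atTop.atTop_div_const (by norm_num)
  have hmem : ∀ N, ∀ u ∈ ball (0 : ℂ) (M N / 2), p N + ρ N * u ∈ ball (0 : ℂ) 1 := by
    intro N u hu
    have := (h2 N u (by simpa using (mem_ball_zero_iff.1 hu).le)).1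
    exact ball_subset_ball (by norm_num) this
  have hFd : ∀ N, DifferentiableOn ℂ (fun u => h N (p N + ρ N * u)) (ball 0 (M N / 2)) := by
    intro N
    apply (hd N).comp (by fun_prop)
    intro u hu; exact hmem N u hu
  obtain ⟨H, hHd, hH0, hlim⟩ := ultralimit l (fun N u => h N (p N + ρ N * u)) (fun N => M N / 2) hR
    (Eventually.of_forall hFd)
    (Eventually.of_forall fun N u hu => (h2 N u (mem_ball_zero_iff.1 hu).le).2)
    (Eventually.of_forall h1)
  obtain ⟨a, b, hab⟩ := nonconst_of_sph hH0
  refine hab (const_of_avoid_circle hHd ?_ a b)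
  intro z hz
  have hA : AnalyticOnNhd ℂ H univ := hHd.differentiableOn.analyticOnNhd isOpen_univ
  have hnb : H '' univ ∈ 𝓝 (H z) := by
    rcases (hA z (mem_univ _)).eventually_constant_or_nhds_le_map_nhds with h | h
    · exfalso
      have := hA.eqOn_of_preconnected_of_eventuallyEq analyticOnNhd_const isPreconnected_univ
        (mem_univ z) h
      exact hab ((this (mem_univ a)).trans (this (mem_univ b)).symm)
    · exact h (image_mem_map univ_mem)
  obtain ⟨ξ, ⟨v, -, rfl⟩, m, hm⟩ := dyadic_root_dense (H z) hz hnb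
  have hhw := hurwitz (l : Filter ℕ) _ H hHd hlim ⟨a, b, hab⟩ v one_pos (by
    filter_upwards [hR.eventually_ge_atTop (1 + ‖v‖)] with N hN
    exact (hFd N).mono (ball_subset_ball' (by simpa using hN)))
  obtain ⟨N, ⟨w, hw, hwe⟩, hNR, hNm⟩ := (hhw.and ((hR.eventually_ge_atTop (1 + ‖v‖)).and
    (hl (eventually_ge_atTop m)))).exists
  apply ho N (p N + ρ N * w)
  · apply hmem
    exact ball_subset_ball' (by simpa using hNR) hw
  · rw [hwe, ← Nat.sub_add_cancel hNm, pow_add, mul_comm, pow_mul, hm, one_pow]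

lemma montel_scaled : ∃ K : ℝ, 1 ≤ K ∧ ∀ (f : ℂ → ℂ) (u : ℂ) (r : ℝ), 0 < r →
    DifferentiableOn ℂ f (ball u r) → (∀ z ∈ ball u r, f z ≠ 0 ∧ f z ≠ 1) → r * sph f u ≤ K := by
  obtain ⟨K, hK1, hK⟩ := montel_const
  refine ⟨K, hK1, fun f u r hr hf ho => ?_⟩
  have hm : ∀ w ∈ ball (0 : ℂ) 1, u + r * w ∈ ball u r := by
    intro w hw
    rw [mem_ball_zero_iff] at hw
    rw [mem_ball_iff_norm, add_sub_cancel_left, norm_mul, Complex.norm_real,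
      Real.norm_of_nonneg hr.le]
    nlinarith
  have := hK (fun w => f (u + r * w)) (hf.comp (by fun_prop) hm) (fun z hz => ho _ (hm z hz))
  rw [sph_comp_affine _ _ _ hr.le] at this
  simpa using this

lemma picard {F : ℂ → ℂ} (hF : Differentiable ℂ F) {a b : ℂ} (hab : a ≠ b) (ha : ∀ z, F z ≠ a)
    (hb : ∀ z, F z ≠ b) (x y : ℂ) : F x = F y := by
  obtain ⟨K, hK1, hK⟩ := montel_scaled
  have hba : b - a ≠ 0 := sub_ne_zero.2 hab.symm
  set G := fun z => (F z - a) / (b - a) with hG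
  have hGd : Differentiable ℂ G := (hF.sub_const _).div_const _
  have hs : ∀ u, sph G u = 0 := by
    intro u
    by_contra hne
    have hpos : 0 < sph G u := lt_of_le_of_ne (sph_nonneg _ _) (Ne.symm hne)
    have := hK G u ((K + 1) / sph G u) (by positivity) hGd.differentiableOn (fun z _ => by
      constructor
      · simp [hG, sub_ne_zero.2 (ha z), hba]
      · intro h
        rw [hG] at h; simp only at h
        rw [div_eq_one_iff_eq hba] at h
        exact hb z (by linear_combination h))
    rw [div_mul_cancel₀ _ hpos.ne'] at this
    linarith
  have hd : ∀ u, deriv G u = 0 := by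
    intro u
    have := hs u
    unfold sph at this
    rw [div_eq_zero_iff] at this
    rcases this with h | h
    · simpa using h
    · have : (0 : ℝ) < 1 + ‖G u‖ ^ 2 := by positivity
      linarith
  have := is_const_of_deriv_eq_zero hGd hd x y
  simp only [hG] at this
  field_simp at this
  linear_combination this

lemma omit_step : ∃ η : ℝ, 0 < η ∧ η ≤ 1 / 4 ∧ ∀ (h : ℂ → ℂ) (u v : ℂ) (r A : ℝ), 0 < r →
    DifferentiableOn ℂ h (ball u r) → (∀ z ∈ ball u r, h z ≠ 0 ∧ h z ≠ 1) → 3 ≤ A → ‖h u‖ ≤ A →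
    ‖v - u‖ ≤ η * r → ‖h v‖ ≤ A ^ 3 := by
  obtain ⟨K, hK1, hK⟩ := montel_scaled
  refine ⟨1 / (40 * K), by positivity, ?_, ?_⟩
  · apply one_div_le_one_div_of_le (by norm_num); linarith
  intro h u v r A hr hd ho hA hu hv
  have hr' : r / (20 * K) ≤ r / 2 := by
    apply div_le_div_of_nonneg_left hr.le (by norm_num); linarith
  have hs1 : ball u (r / (20 * K)) ⊆ ball u r := ball_subset_ball (by linarith)
  refine st_step (K := 2 * K / r) (r := r / (20 * K)) (hd.mono hs1) ?_ (by positivity) ?_ hA hu ?_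
  · intro z hz
    have hzz : ball z (r / 2) ⊆ ball u r := by
      apply ball_subset_ball'
      have := mem_ball.1 hz; linarith
    have := hK h z (r / 2) (by positivity) (hd.mono hzz) (fun w hw => ho w (hzz hw))
    rw [le_div_iff₀ hr]; linarith
  · apply le_of_eq; field_simp; norm_num
  · convert! hv using 1; field_simp; norm_num


lemma countable_zeros {h : ℂ → ℂ} (hh : Differentiable ℂ h) (hne : ∃ z, h z ≠ 0) :
    {z | h z = 0}.Countable := by
  have hA : AnalyticOnNhd ℂ h univ := hh.differentiableOn.analyticOnNhd isOpen_univ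
  obtain ⟨t, hts, htc, hcov⟩ := TopologicalSpace.countable_cover_nhdsWithin
    (f := fun x => ({x} : Set ℂ)) (s := {z | h z = 0}) (by
      intro x hx
      have hev : ∀ᶠ z in 𝓝[≠] x, h z ≠ 0 := by
        rcases (hA x (mem_univ _)).eventually_eq_zero_or_eventually_ne_zero with h1 | h1
        · exfalso
          obtain ⟨z, hz⟩ := hne
          exact hz (hA.eqOn_zero_of_preconnected_of_eventuallyEq_zero isPreconnected_univ
            (mem_univ x) h1 (mem_univ z))
        · exact h1
      rw [eventually_nhdsWithin_iff] at hev
      change ∀ᶠ z in 𝓝[{z | h z = 0}] x, z ∈ ({x} : Set ℂ)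
      rw [eventually_nhdsWithin_iff]
      filter_upwards [hev] with z hz hz0
      by_contra hzx
      exact hz hzx hz0)
  apply htc.mono
  intro x hx
  have := hcov hx
  simp only [mem_iUnion, mem_singleton_iff, exists_prop] at this
  obtain ⟨y, hy, rfl⟩ := this
  exact hy

lemma inv_branch {F : ℂ → ℂ} (hF : Differentiable ℂ F) {a u₀ z₀ : ℂ} {r : ℝ} (ha : a ≠ 0)
    (hr : 0 < r) (hder : ∀ u ∈ closedBall u₀ r, ‖deriv F u - a‖ ≤ ‖a‖ / 2)
    (hz : ‖F u₀ - z₀‖ ≤ ‖a‖ * r / 8) :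
    ∃ ψ : ℂ → ℂ, DifferentiableOn ℂ ψ (ball z₀ (‖a‖ * r / 8)) ∧
      ∀ z ∈ ball z₀ (‖a‖ * r / 8), ψ z ∈ closedBall u₀ r ∧ F (ψ z) = z := by
  have ha' : 0 < ‖a‖ := norm_pos_iff.2 ha
  have hexp : ∀ x ∈ closedBall u₀ r, ∀ y ∈ closedBall u₀ r,
      ‖a‖ / 2 * ‖y - x‖ ≤ ‖F y - F x‖ := by
    intro x hx y hy
    have h1 : ∀ u ∈ closedBall u₀ r, HasDerivWithinAt (fun z => F z - a * z) (deriv F u - a)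
        (closedBall u₀ r) u := by
      intro u _
      have := ((hF u).hasDerivAt.sub ((hasDerivAt_id u).const_mul a)).hasDerivWithinAt
        (s := closedBall u₀ r)
      rw [mul_one] at this
      exact this
    have h2 := (convex_closedBall u₀ r).norm_image_sub_le_of_norm_hasDerivWithin_le h1 hder hx hy
    have h3 : a * (y - x) = (F y - F x) - ((F y - a * y) - (F x - a * x)) := by ring
    have h4 := norm_sub_le (F y - F x) ((F y - a * y) - (F x - a * x))
    rw [← h3, norm_mul] at h4
    linarith
  have hu0 : u₀ ∈ closedBall u₀ r := mem_closedBall_self hr.le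
  have himg : ball (F u₀) (‖a‖ / 2 * r / 2) ⊆ F '' closedBall u₀ r := by
    apply (hF.diffContOnCl).ball_subset_image_closedBall hr
    · intro z hz
      have := hexp u₀ hu0 z (sphere_subset_closedBall hz)
      rwa [mem_sphere_iff_norm.1 hz] at this
    · have : ∀ᶠ z in 𝓝[≠] u₀, F z ≠ F u₀ := by
        rw [eventually_nhdsWithin_iff]
        filter_upwards [closedBall_mem_nhds u₀ hr] with z hz hne he
        have := hexp u₀ hu0 z hz
        rw [he, sub_self, norm_zero] at this
        have h5 : 0 < ‖z - u₀‖ := norm_pos_iff.2 (sub_ne_zero.2 hne)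
        have : 0 < ‖a‖ / 2 * ‖z - u₀‖ := by positivity
        linarith
      exact this.frequently.filter_mono nhdsWithin_le_nhds
  have hinv : ∀ z ∈ ball z₀ (‖a‖ * r / 8), ∃ u ∈ closedBall u₀ r, F u = z := by
    intro z hzb
    obtain ⟨u, hu, hue⟩ := himg (show z ∈ ball (F u₀) (‖a‖ / 2 * r / 2) by
      rw [mem_ball_iff_norm] at hzb ⊢
      have : z - F u₀ = (z - z₀) - (F u₀ - z₀) := by ring
      rw [this]
      have := norm_sub_le (z - z₀) (F u₀ - z₀)
      linarith)
    exact ⟨u, hu, hue⟩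
  choose! ψ hψ hψe using hinv
  refine ⟨ψ, ?_, fun z hz => ⟨hψ z hz, hψe z hz⟩⟩
  intro z hz
  apply DifferentiableAt.differentiableWithinAt
  have hcont : ContinuousAt ψ z := by
    have hlip : ∀ w ∈ ball z₀ (‖a‖ * r / 8), ‖ψ w - ψ z‖ ≤ 2 / ‖a‖ * ‖w - z‖ := by
      intro w hw
      have := hexp _ (hψ z hz) _ (hψ w hw)
      rw [hψe z hz, hψe w hw] at this
      rw [div_mul_eq_mul_div, le_div_iff₀ ha']; linarith
    change Tendsto ψ (𝓝 z) (𝓝 (ψ z))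
    rw [tendsto_iff_norm_sub_tendsto_zero]
    apply squeeze_zero' (g := fun w => 2 / ‖a‖ * ‖w - z‖)
      (Eventually.of_forall fun w => norm_nonneg _)
    · filter_upwards [isOpen_ball.mem_nhds hz] with w hw using hlip w hw
    · have : Continuous fun w : ℂ => 2 / ‖a‖ * ‖w - z‖ := by fun_prop
      simpa using this.tendsto z
  have hne : deriv F (ψ z) ≠ 0 := by
    intro h
    have := hder _ (hψ z hz)
    rw [h, zero_sub, norm_neg] at this
    linarith
  exact (HasDerivAt.of_local_left_inverse hcont (hF (ψ z)).hasDerivAt hne (by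
    filter_upwards [isOpen_ball.mem_nhds hz] with w hw using hψe w hw)).differentiableAt

lemma branch_lemma (l : Ultrafilter ℕ) (f : ℕ → ℂ → ℂ) (hf : ∀ n, Differentiable ℂ (f n))
    (v : ℕ → ℂ) (hv : Tendsto (fun n => sph (f n) (v n)) (l : Filter ℕ) atTop) {δ : ℝ}
    (hδ : 0 < δ) :
    ∃ E : Set ℂ, E.Countable ∧ ∀ z₀ ∉ E, ∃ ε > 0, ∀ᶠ n in (l : Filter ℕ), ∃ φ : ℂ → ℂ,
      DifferentiableOn ℂ φ (ball z₀ ε) ∧ ∀ z ∈ ball z₀ ε, f n (φ z) = z ∧ φ z ∈ ball (v n) δ := by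
  have hz : ∀ n, ∃ (p : ℂ) (ρ M : ℝ), 0 < sph (f n) (v n) → (0 < ρ ∧ δ * sph (f n) (v n) ≤ M ∧
      sph (fun u => f n (p + ρ * u)) 0 = 1 ∧
      ∀ u : ℂ, ‖u‖ ≤ M / 2 → p + ρ * u ∈ ball (v n) δ ∧ sph (fun u => f n (p + ρ * u)) u ≤ 2) := by
    intro n
    by_cases h : 0 < sph (f n) (v n)
    · obtain ⟨p, ρ, M, hh⟩ := zalcman isOpen_univ (hf n).differentiableOn
        (subset_univ (closedBall (v n) δ)) hδ h
      exact ⟨p, ρ, M, fun _ => hh⟩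
    · exact ⟨0, 0, 0, fun h' => absurd h' h⟩
  choose p ρ M hM using hz
  have hev : ∀ᶠ n in (l : Filter ℕ), 0 < sph (f n) (v n) := hv.eventually_gt_atTop 0
  have hMt : Tendsto (fun n => M n / 2) (l : Filter ℕ) atTop := by
    have h1 : Tendsto (fun n => δ * sph (f n) (v n) / 2) (l : Filter ℕ) atTop :=
      (hv.const_mul_atTop hδ).atTop_div_const two_pos
    refine tendsto_atTop_mono' _ ?_ h1
    filter_upwards [hev] with n hn
    have := (hM n hn).2.1
    linarith
  set F : ℕ → ℂ → ℂ := fun n u => f n (p n + ρ n * u) with hFdef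
  have hFd : ∀ n, Differentiable ℂ (F n) := fun n => (hf n).comp (by fun_prop)
  obtain ⟨H, hHd, hH0, hlim⟩ := ultralimit l F (fun n => M n / 2) hMt
    (Eventually.of_forall fun n => (hFd n).differentiableOn)
    (by filter_upwards [hev] with n hn u hu using ((hM n hn).2.2.2 u (mem_ball_zero_iff.1 hu).le).2)
    (by filter_upwards [hev] with n hn using (hM n hn).2.2.1)
  obtain ⟨a₁, b₁, hab⟩ := nonconst_of_sph hH0
  have hdH : Differentiable ℂ (deriv H) := by
    intro z
    exact (hHd.analyticAt z).deriv.differentiableAt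
  refine ⟨(range H)ᶜ ∪ H '' {u | deriv H u = 0}, ?_, ?_⟩
  · apply Countable.union
    · apply Subsingleton.countable
      intro a ha b hb
      by_contra hne
      exact hab (picard hHd hne (fun z h => ha ⟨z, h⟩) (fun z h => hb ⟨z, h⟩) a₁ b₁)
    · apply Countable.image
      apply countable_zeros hdH
      by_contra hcon
      push Not at hcon
      exact hab (is_const_of_deriv_eq_zero hHd hcon a₁ b₁)
  intro z₀ hz₀
  simp only [mem_union, mem_compl_iff, not_or, not_not] at hz₀
  obtain ⟨⟨u₀, rfl⟩, hcrit⟩ := hz₀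
  have ha : deriv H u₀ ≠ 0 := fun h => hcrit ⟨u₀, h, rfl⟩
  set a := deriv H u₀ with hadef
  have ha' : 0 < ‖a‖ := norm_pos_iff.2 ha
  have hcont : ∀ᶠ u in 𝓝 u₀, ‖deriv H u - a‖ < ‖a‖ / 4 := by
    have := Metric.tendsto_nhds.1 (hdH.continuous.tendsto u₀) (‖a‖ / 4) (by positivity)
    simpa [dist_eq_norm] using this
  obtain ⟨r, hr, hrb⟩ := Metric.nhds_basis_closedBall.eventually_iff.1 hcont
  refine ⟨‖a‖ * r / 8, by positivity, ?_⟩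
  have hU : TendstoLocallyUniformlyOn F H (l : Filter ℕ) univ := hlim.tendstoLocallyUniformlyOn
  have hD := hU.deriv (Eventually.of_forall fun n => (hFd n).differentiableOn) isOpen_univ
  have hDu : TendstoUniformlyOn (deriv ∘ F) (deriv H) (l : Filter ℕ) (closedBall u₀ r) :=
    (tendstoLocallyUniformlyOn_iff_tendstoUniformlyOn_of_compact (isCompact_closedBall u₀ r)).1
      (hD.mono (subset_univ _))
  have he1 := Metric.tendstoUniformlyOn_iff.1 hDu (‖a‖ / 4) (by positivity)
  have he2 := Metric.tendsto_nhds.1 (hU.tendsto_at (mem_univ u₀)) (‖a‖ * r / 8) (by positivity)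
  filter_upwards [hev, he1, he2, hMt.eventually_ge_atTop (‖u₀‖ + r)] with n hn h1 h2 h3
  obtain ⟨ψ, hψd, hψ⟩ := inv_branch (hFd n) (u₀ := u₀) (z₀ := H u₀) ha hr (by
    intro u hu
    have e1 := h1 u hu
    have e2 := hrb hu
    rw [dist_eq_norm] at e1
    have : deriv (F n) u - a = (deriv H u - a) - (deriv H u - deriv (F n) u) := by ring
    rw [this]
    refine (norm_sub_le _ _).trans ?_
    simp only [Function.comp] at e1
    linarith) (by rw [dist_eq_norm] at h2; exact h2.le)
  refine ⟨fun z => p n + ρ n * ψ z, (hψd.const_mul _).const_add _, fun z hz => ?_⟩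
  obtain ⟨k1, k2⟩ := hψ z hz
  refine ⟨k2, ((hM n hn).2.2.2 (ψ z) ?_).1⟩
  refine le_trans ?_ h3
  have := norm_le_norm_add_norm_sub' (ψ z) u₀
  rw [mem_closedBall_iff_norm] at k1
  linarith


lemma narrow (M : ℕ) : ∃ τ : ℝ, 0 < τ ∧ τ ≤ 1 / 2 ∧ ∀ w : ℂ, 0 < w.re → |w.im| ≤ τ * w.re →
    1 / 2 * (w.re⁻¹) ^ M ≤ ((w⁻¹) ^ M).re := by
  have hc : ContinuousAt (fun t : ℝ => (((1 + t * Complex.I : ℂ)⁻¹) ^ M).re) 0 := by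
    apply Complex.continuous_re.continuousAt.comp
    apply ContinuousAt.pow
    apply ContinuousAt.inv₀
    · fun_prop
    · simp
  have hev : ∀ᶠ t : ℝ in 𝓝 (0 : ℝ), 1 / 2 < (((1 + t * Complex.I : ℂ)⁻¹) ^ M).re := by
    apply hc.eventually_const_lt
    simp; norm_num
  obtain ⟨τ, hτ, hb⟩ := Metric.nhds_basis_closedBall.eventually_iff.1 hev
  refine ⟨min τ (1 / 2), by positivity, min_le_right _ _, ?_⟩
  intro w hw him
  set t := w.im / w.re with ht
  have hwe : w = (w.re : ℂ) * (1 + t * Complex.I) := by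
    apply Complex.ext
    · simp
    · simp [ht]; field_simp
  have htb : t ∈ closedBall (0 : ℝ) τ := by
    rw [mem_closedBall_zero_iff, Real.norm_eq_abs, ht, abs_div, abs_of_pos hw, div_le_iff₀ hw]
    exact him.trans (by gcongr; exact min_le_left _ _)
  have h1 := hb htb
  have h2 : ((w⁻¹) ^ M).re = (w.re⁻¹) ^ M * (((1 + t * Complex.I : ℂ)⁻¹) ^ M).re := by
    conv_lhs => rw [hwe]
    rw [mul_inv, mul_pow]
    rw [show ((w.re : ℂ)⁻¹) ^ M = (((w.re⁻¹) ^ M : ℝ) : ℂ) by push_cast; rfl, Complex.re_ofReal_mul]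
  rw [h2]
  have : 0 ≤ (w.re⁻¹) ^ M := by positivity
  nlinarith

lemma rhombus (M : ℕ) (hM : 1 ≤ M) (C s Y : ℝ) (hC : 0 < C) (hs : 0 < s) (hY : 0 < Y) :
    ∃ s' > 0, ∃ C' : ℝ, ∀ ψ : ℂ → ℂ, DifferentiableOn ℂ ψ (ball 0 (2 * s)) →
      (∀ z : ℂ, |z.re| ≤ s → 0 < |z.im| → |z.im| ≤ Y → ‖ψ z‖ ≤ Real.exp (C / |z.im| ^ M)) →
      ∀ z ∈ ball (0 : ℂ) s', ‖ψ z‖ ≤ C' := by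
  obtain ⟨τ₀, hτ₀, hτ₀h, hnar₀⟩ := narrow M
  set τ := min τ₀ (Y / s) with hτdef
  have hτ : 0 < τ := by positivity
  have hτh : τ ≤ 1 / 2 := (min_le_left _ _).trans hτ₀h
  have hτY : τ * s ≤ Y := by
    have : τ ≤ Y / s := min_le_right _ _
    rwa [le_div_iff₀ hs] at this
  have hnar : ∀ w : ℂ, 0 < w.re → |w.im| ≤ τ * w.re → 1 / 2 * (w.re⁻¹) ^ M ≤ ((w⁻¹) ^ M).re := by
    intro w hw h
    exact hnar₀ w hw (h.trans (by gcongr; exact min_le_left _ _))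
  set A := 2 * C / τ ^ M with hA
  have hApos : 0 < A := by positivity
  let S : ℂ → ℂ := fun z => ((s + z)⁻¹) ^ M + ((s - z)⁻¹) ^ M
  have hSre : ∀ z : ℂ, |z.re| < s → |z.im| ≤ τ * (s - |z.re|) →
      1 / 2 * ((s - |z.re|)⁻¹) ^ M ≤ (S z).re := by
    intro z hx hy
    have hx' := abs_lt.1 hx
    have hle1 := le_abs_self z.re
    have hle2 := neg_abs_le z.re
    have k1 := hnar ((s : ℂ) + z) (by simp; linarith) (by
      simp only [Complex.add_re, Complex.add_im, Complex.ofReal_re, Complex.ofReal_im, zero_add]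
      refine hy.trans (mul_le_mul_of_nonneg_left ?_ hτ.le); linarith)
    have k2 := hnar ((s : ℂ) - z) (by simp; linarith) (by
      simp only [Complex.sub_re, Complex.sub_im, Complex.ofReal_re, Complex.ofReal_im, zero_sub,
        abs_neg]
      refine hy.trans (mul_le_mul_of_nonneg_left ?_ hτ.le); linarith)
    simp only [Complex.add_re, Complex.sub_re, Complex.ofReal_re] at k1 k2
    have e1 : 0 ≤ 1 / 2 * ((s + z.re)⁻¹) ^ M := by
      have : 0 < s + z.re := by linarith
      positivity
    have e2 : 0 ≤ 1 / 2 * ((s - z.re)⁻¹) ^ M := by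
      have : 0 < s - z.re := by linarith
      positivity
    simp only [S, Complex.add_re]
    rcases abs_cases z.re with ⟨h, _⟩ | ⟨h, _⟩
    · rw [h]; linarith
    · rw [h, sub_neg_eq_add]; linarith
  refine ⟨min (s / 4) (τ * s / 4), by positivity, Real.exp (A * (2 * (2 / s) ^ M)), ?_⟩
  intro ψ hψ hb z hz
  -- bound on the closed rhombus
  have hcpt : IsCompact {w : ℂ | |w.re| ≤ s ∧ |w.im| ≤ τ * (s - |w.re|)} := by
    apply (isCompact_closedBall (0 : ℂ) (2 * s)).of_isClosed_subset
    · apply IsClosed.and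
      · exact isClosed_le (by fun_prop) (by fun_prop)
      · exact isClosed_le (by fun_prop) (by fun_prop)
    · rintro w ⟨h1, h2⟩
      rw [mem_closedBall_zero_iff]
      have := Complex.norm_le_abs_re_add_abs_im w
      have := abs_nonneg w.re
      nlinarith
  have hsubb : {w : ℂ | |w.re| ≤ s ∧ |w.im| ≤ τ * (s - |w.re|)} ⊆ ball 0 (2 * s) := by
    rintro w ⟨h1, h2⟩
    rw [mem_ball_zero_iff]
    have := Complex.norm_le_abs_re_add_abs_im w
    have := abs_nonneg w.re
    nlinarith
  obtain ⟨B, hB⟩ := hcpt.exists_bound_of_continuousOn (hψ.continuousOn.mono hsubb)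
  set b := Real.log (max B 1) with hbdef
  have hb0 : 0 ≤ b := Real.log_nonneg (le_max_right _ _)
  have hBe : B ≤ Real.exp b := by
    rw [hbdef, Real.exp_log (by positivity)]; exact le_max_left _ _
  set κ := min (min (s / 2) 1) (A / (2 * (b + 1))) with hκ
  have hκ0 : 0 < κ := by positivity
  have hκs : κ ≤ s / 2 := (min_le_left _ _).trans (min_le_left _ _)
  have hκ1 : κ ≤ 1 := (min_le_left _ _).trans (min_le_right _ _)
  have hκb : b ≤ A * (1 / 2 * (κ⁻¹) ^ M) := by
    have h1 : κ ≤ A / (2 * (b + 1)) := min_le_right _ _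
    rw [le_div_iff₀ (by positivity)] at h1
    have h2 : κ⁻¹ ≤ (κ⁻¹) ^ M := le_self_pow₀ ((one_le_inv₀ hκ0).2 hκ1) (by omega)
    have h3 : b + 1 ≤ A * (1 / 2 * κ⁻¹) := by
      have : A * (1 / 2 * κ⁻¹) = (A / 2) / κ := by field_simp
      rw [this, le_div_iff₀ hκ0]; linarith
    have h4 : A * (1 / 2 * κ⁻¹) ≤ A * (1 / 2 * (κ⁻¹) ^ M) := by gcongr
    linarith
  let hh : ℂ → ℝ := fun w => max (|w.im| - τ * (s - |w.re|)) (|w.re| - (s - κ))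
  have hhc : Continuous hh := by
    simp only [hh]; fun_prop
  let U : Set ℂ := {w | hh w < 0}
  have hUle : closure U ⊆ {w | hh w ≤ 0} := closure_lt_subset_le hhc continuous_const
  have hUf : frontier U ⊆ {w | hh w = 0} := frontier_lt_subset_eq hhc continuous_const
  have hcl : ∀ w, hh w ≤ 0 → |w.re| ≤ s - κ ∧ |w.im| ≤ τ * (s - |w.re|) := by
    intro w hw
    have := max_le_iff.1 hw
    constructor <;> linarith [this.1, this.2]
  have hR : ∀ w, hh w ≤ 0 → w ∈ {w : ℂ | |w.re| ≤ s ∧ |w.im| ≤ τ * (s - |w.re|)} := fun w hw =>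
    ⟨by linarith [(hcl w hw).1], (hcl w hw).2⟩
  have hUb : Bornology.IsBounded U := by
    apply hcpt.isBounded.subset
    intro w hw; exact hR w (le_of_lt hw)
  let G : ℂ → ℂ := fun w => ψ w * Complex.exp (-(A : ℂ) * S w)
  have hnormG : ∀ w, ‖G w‖ = ‖ψ w‖ * Real.exp (-(A * (S w).re)) := by
    intro w
    simp only [G, norm_mul, Complex.norm_exp]
    congr 2
    rw [← Complex.ofReal_neg, Complex.re_ofReal_mul]; ring
  have hSd : ∀ w : ℂ, |w.re| < s → DifferentiableAt ℂ S w := by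
    intro w hw
    have hx' := abs_lt.1 hw
    have n1 : (s : ℂ) + w ≠ 0 := fun h => by
      have := congrArg Complex.re h; simp at this; linarith
    have n2 : (s : ℂ) - w ≠ 0 := fun h => by
      have := congrArg Complex.re h; simp at this; linarith
    simp only [S]
    apply DifferentiableAt.add
    · exact (DifferentiableAt.inv (by fun_prop) n1).pow M
    · exact (DifferentiableAt.inv (by fun_prop) n2).pow M
  have hGd : DiffContOnCl ℂ G U := by
    have : DifferentiableOn ℂ G (closure U) := by
      intro w hw
      have hw' := hUle hw
      have h1 : DifferentiableAt ℂ ψ w :=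
        hψ.differentiableAt (isOpen_ball.mem_nhds (hsubb (hR w hw')))
      have h2 := hSd w (by linarith [(hcl w hw').1])
      exact (h1.mul (h2.const_mul _).cexp).differentiableWithinAt
    exact this.diffContOnCl
  have hfr : ∀ w ∈ frontier U, ‖G w‖ ≤ 1 := by
    intro w hw
    have h0 : hh w = 0 := hUf hw
    have hle := hcl w h0.le
    have hSw := hSre w (by linarith [hle.1]) hle.2
    have hmul : A * (1 / 2 * ((s - |w.re|)⁻¹) ^ M) ≤ A * (S w).re := by gcongr
    rw [hnormG]
    have hfin : ∀ c, c ≤ A * (S w).re → ‖ψ w‖ ≤ Real.exp c → ‖ψ w‖ * Real.exp (-(A * (S w).re)) ≤ 1 := by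
      intro c hc hψc
      calc ‖ψ w‖ * Real.exp (-(A * (S w).re)) ≤ Real.exp c * Real.exp (-c) := by gcongr
        _ = 1 := by rw [← Real.exp_add]; simp
    have hd : 0 < s - |w.re| := by linarith [hle.1]
    rcases max_choice (|w.im| - τ * (s - |w.re|)) (|w.re| - (s - κ)) with h | h
    · have hy : |w.im| = τ * (s - |w.re|) := by
        have : hh w = _ := h
        linarith
      refine hfin _ hmul ?_
      have hpos : 0 < |w.im| := by rw [hy]; positivity
      refine (hb w (by linarith) hpos ?_).trans ?_
      · rw [hy]; refine le_trans ?_ hτY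
        have := abs_nonneg w.re
        gcongr; linarith
      · apply Real.exp_le_exp.2
        rw [hy, hA, mul_pow, inv_pow]
        apply le_of_eq; field_simp
    · have hx : s - |w.re| = κ := by
        have : hh w = _ := h
        linarith
      rw [hx] at hmul
      exact hfin b (hκb.trans hmul) ((hB w (hR w h0.le)).trans hBe)
  have hzn : ‖z‖ < min (s / 4) (τ * s / 4) := by simpa using hz
  have hz1 : ‖z‖ < s / 4 := hzn.trans_le (min_le_left _ _)
  have hz2 : ‖z‖ < τ * s / 4 := hzn.trans_le (min_le_right _ _)
  have hzre := Complex.abs_re_le_norm z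
  have hzim := Complex.abs_im_le_norm z
  have hzU : z ∈ U := by
    change hh z < 0
    apply max_lt
    · have : τ * (s / 2) ≤ τ * (s - |z.re|) := by gcongr; linarith
      have : 0 < τ * s := by positivity
      linarith
    · linarith
  have hfinal := Complex.norm_le_of_forall_mem_frontier_norm_le hUb hGd hfr (subset_closure hzU)
  rw [hnormG] at hfinal
  have hSle : (S z).re ≤ 2 * (2 / s) ^ M := by
    refine (Complex.re_le_norm _).trans ?_
    have aux : ∀ w : ℂ, ‖w‖ < s / 4 → ‖((s + w)⁻¹) ^ M‖ ≤ (2 / s) ^ M := by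
      intro w hw
      rw [norm_pow, norm_inv]
      gcongr
      rw [show 2 / s = (s / 2)⁻¹ by field_simp]
      apply inv_anti₀ (by positivity)
      have h1 := norm_sub_norm_le (s : ℂ) (-w)
      rw [Complex.norm_real, Real.norm_of_nonneg hs.le, norm_neg, sub_neg_eq_add] at h1
      linarith
    have a1 := aux z hz1
    have a2 := aux (-z) (by simpa using hz1)
    rw [← sub_eq_add_neg] at a2
    exact (norm_add_le _ _).trans (by linarith)
  have : ‖ψ z‖ ≤ Real.exp (A * (S z).re) := by
    rw [Real.exp_neg, ← div_eq_mul_inv, div_le_one (Real.exp_pos _)] at hfinal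
    exact hfinal
  exact this.trans (Real.exp_le_exp.2 (by gcongr))



/-- the step constant property -/
def OmitStep (η : ℝ) : Prop := 0 < η ∧ η ≤ 1 / 4 ∧ ∀ (h : ℂ → ℂ) (u v : ℂ) (r A : ℝ), 0 < r →
    DifferentiableOn ℂ h (ball u r) → (∀ z ∈ ball u r, h z ≠ 0 ∧ h z ≠ 1) → 3 ≤ A → ‖h u‖ ≤ A →
    ‖v - u‖ ≤ η * r → ‖h v‖ ≤ A ^ 3

lemma seg_chain {η : ℝ} (hη : OmitStep η) {ψ : ℂ → ℂ} {p q : ℂ} {r A : ℝ} {k : ℕ} (hk : 0 < k)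
    (hr : 0 < r)
    (hd : ∀ t ∈ Icc (0 : ℝ) 1, DifferentiableOn ℂ ψ (ball (p + t * (q - p)) r))
    (ho : ∀ t ∈ Icc (0 : ℝ) 1, ∀ z ∈ ball (p + t * (q - p)) r, ψ z ≠ 0 ∧ ψ z ≠ 1)
    (hA : 3 ≤ A) (hp : ‖ψ p‖ ≤ A) (hlen : ‖q - p‖ ≤ k * (η * r)) : ‖ψ q‖ ≤ A ^ (3 ^ k) := by
  have hk' : (0 : ℝ) < k := by exact_mod_cast hk
  have key : ∀ j : ℕ, j ≤ k → ‖ψ (p + ((j / k : ℝ) : ℂ) * (q - p))‖ ≤ A ^ (3 ^ j) := by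
    intro j
    induction j with
    | zero => intro _; simpa using hp
    | succ j ih =>
      intro hj
      have hjk : (j : ℝ) ≤ k := by exact_mod_cast (by omega : j ≤ k)
      have hmem : (j / k : ℝ) ∈ Icc (0 : ℝ) 1 := ⟨by positivity, by rw [div_le_one hk']; exact hjk⟩
      have := hη.2.2 ψ _ (p + (((j + 1 : ℕ) / k : ℝ) : ℂ) * (q - p)) r _ hr (hd _ hmem) (ho _ hmem)
        (hA.trans (le_self_pow₀ (by linarith) (by positivity))) (ih (by omega)) (by
          have e : p + (((j + 1 : ℕ) / k : ℝ) : ℂ) * (q - p) - (p + ((j / k : ℝ) : ℂ) * (q - p))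
            = ((1 / k : ℝ) : ℂ) * (q - p) := by push_cast; ring
          rw [e, norm_mul, Complex.norm_real, Real.norm_of_nonneg (by positivity)]
          rw [one_div, inv_mul_le_iff₀ hk']; exact hlen)
      rwa [← pow_mul, ← pow_succ] at this
  have := key k le_rfl
  rw [div_self hk'.ne'] at this
  simpa using this

lemma vert_growth {η : ℝ} (hη : OmitStep η) : ∃ M : ℕ, 1 ≤ M ∧ ∀ ε Y x₀ A : ℝ, 0 < ε → 0 < Y → Y < ε / 4 →
    |x₀| ≤ ε / 4 → 3 ≤ A → ∃ C > 0, ∀ ψ : ℂ → ℂ, DifferentiableOn ℂ ψ (ball 0 ε) →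
      (∀ z ∈ ball (0 : ℂ) ε, 0 < z.im → ψ z ≠ 0 ∧ ψ z ≠ 1) → ‖ψ (x₀ + Y * Complex.I)‖ ≤ A →
      ∀ z : ℂ, |z.re| ≤ ε / 4 → 0 < z.im → z.im ≤ Y → ‖ψ z‖ ≤ Real.exp (C / z.im ^ M) := by
  have hη0 := hη.1
  have hη1 := hη.2.1
  obtain ⟨M₀, hM₀⟩ : ∃ M : ℕ, (1 - η) ^ M < 1 / 3 :=
    exists_pow_lt_of_lt_one (by norm_num) (by linarith)
  have h1η : 0 < 1 - η := by linarith
  set M := M₀ + 1 with hM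
  have hM3 : 3 ≤ ((1 - η)⁻¹) ^ M := by
    rw [inv_pow, le_inv_comm₀ (by norm_num) (by positivity), hM, pow_succ]
    have : (1 - η) ^ M₀ * (1 - η) ≤ (1 - η) ^ M₀ := mul_le_of_le_one_right (by positivity) (by linarith)
    linarith
  refine ⟨M, by omega, ?_⟩
  intro ε Y x₀ A hε hY hYε hx₀ hA
  obtain ⟨k, hk⟩ := exists_nat_gt (ε / (η * Y))
  have hk0 : 0 < k := by
    have : (0 : ℝ) < k := lt_trans (by positivity) hk
    exact_mod_cast this
  set A₁ := A ^ (3 ^ k) with hA₁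
  have hA₁3 : 3 ≤ A₁ := hA.trans (le_self_pow₀ (by linarith) (by positivity))
  have hlogA : 0 < Real.log A₁ := Real.log_pos (by linarith)
  refine ⟨3 * Real.log A₁ * Y ^ M, by positivity, ?_⟩
  intro ψ hd ho hq z hzx hz0 hzY
  have hball : ∀ (x y : ℝ), |x| ≤ ε / 4 → 0 < y → y ≤ Y → ball ((x : ℂ) + y * Complex.I) y ⊆ ball 0 ε ∧
      ∀ w ∈ ball ((x : ℂ) + y * Complex.I) y, 0 < w.im := by
    intro x y hx hy0 hyY
    constructor
    · intro w hw
      rw [mem_ball_iff_norm] at hw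
      rw [mem_ball_zero_iff]
      have h1 : ‖(x : ℂ) + y * Complex.I‖ ≤ |x| + y := by
        refine (norm_add_le _ _).trans ?_
        simp [abs_of_pos hy0]
      have := norm_le_norm_add_norm_sub' w ((x : ℂ) + y * Complex.I)
      linarith
    · intro w hw
      rw [mem_ball_iff_norm] at hw
      have h1 := (Complex.abs_im_le_norm (w - ((x : ℂ) + y * Complex.I))).trans_lt hw
      simp at h1
      linarith [(abs_lt.1 h1).1]
  -- horizontal
  have hhor : ∀ x : ℝ, |x| ≤ ε / 4 → ‖ψ ((x : ℂ) + Y * Complex.I)‖ ≤ A₁ := by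
    intro x hx
    have hpt : ∀ t ∈ Icc (0 : ℝ) 1, ∃ x' : ℝ, |x'| ≤ ε / 4 ∧ ((x₀ : ℂ) + Y * Complex.I) +
        t * (((x : ℂ) + Y * Complex.I) - ((x₀ : ℂ) + Y * Complex.I)) = (x' : ℂ) + Y * Complex.I := by
      intro t ht
      refine ⟨x₀ + t * (x - x₀), ?_, by push_cast; ring⟩
      have a1 := abs_le.1 hx₀
      have a2 := abs_le.1 hx
      rw [abs_le]
      constructor <;> nlinarith [ht.1, ht.2]
    apply seg_chain hη hk0 hY (p := (x₀ : ℂ) + Y * Complex.I)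
    · intro t ht
      obtain ⟨x', hx', he⟩ := hpt t ht
      rw [he]; exact hd.mono (hball x' Y hx' hY le_rfl).1
    · intro t ht w hw
      obtain ⟨x', hx', he⟩ := hpt t ht
      rw [he] at hw
      exact ho w ((hball x' Y hx' hY le_rfl).1 hw) ((hball x' Y hx' hY le_rfl).2 w hw)
    · exact hA
    · exact hq
    · have : (x : ℂ) + Y * Complex.I - ((x₀ : ℂ) + Y * Complex.I) = ((x - x₀ : ℝ) : ℂ) := by
        push_cast; ring
      rw [this, Complex.norm_real, Real.norm_eq_abs]
      rw [div_lt_iff₀ (by positivity)] at hk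
      have := abs_sub x x₀
      linarith
  -- vertical
  have hver : ∀ j : ℕ, ∀ y : ℝ, (1 - η) ^ j * Y ≤ y → y ≤ Y →
      ‖ψ ((z.re : ℂ) + y * Complex.I)‖ ≤ A₁ ^ (3 ^ j) := by
    intro j
    induction j with
    | zero =>
      intro y h1 h2
      have : y = Y := by simp at h1; linarith
      rw [this]; simpa using hhor z.re hzx
    | succ j ih =>
      intro y h1 h2
      have hy0 : 0 < y := lt_of_lt_of_le (by positivity) h1
      set u := min Y (y / (1 - η)) with hu
      have hu0 : 0 < u := by positivity
      have huY : u ≤ Y := min_le_left _ _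
      have hyu : y ≤ u := by
        apply le_min h2
        rw [le_div_iff₀ h1η]; nlinarith
      have hu2 : (1 - η) * u ≤ y := by
        have : u ≤ y / (1 - η) := min_le_right _ _
        rw [le_div_iff₀ h1η] at this; linarith
      have hju : (1 - η) ^ j * Y ≤ u := by
        apply le_min
        · exact mul_le_of_le_one_left hY.le (pow_le_one₀ h1η.le (by linarith))
        · rw [le_div_iff₀ h1η]; rw [pow_succ] at h1; linarith
      have hb := hball z.re u hzx hu0 huY
      have := hη.2.2 ψ ((z.re : ℂ) + u * Complex.I) ((z.re : ℂ) + y * Complex.I) u _ hu0 (hd.mono hb.1)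
        (fun w hw => ho w (hb.1 hw) (hb.2 w hw))
        (hA₁3.trans (le_self_pow₀ (by linarith) (by positivity))) (ih u hju huY) (by
          have e : (z.re : ℂ) + y * Complex.I - ((z.re : ℂ) + u * Complex.I)
            = ((y - u : ℝ) : ℂ) * Complex.I := by push_cast; ring
          rw [e, norm_mul, Complex.norm_I, Complex.norm_real, Real.norm_eq_abs,
            abs_of_nonpos (by linarith)]
          linarith)
      rwa [← pow_mul, ← pow_succ] at this
  obtain ⟨n, hn1, hn2⟩ := exists_nat_pow_near_of_lt_one (x := z.im / Y) (y := 1 - η) (by positivity)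
    (by rw [div_le_one hY]; exact hzY) h1η (by linarith)
  have h1 := hver (n + 1) z.im (by rw [lt_div_iff₀ hY] at hn1; exact hn1.le) hzY
  rw [Complex.re_add_im] at h1
  refine h1.trans ?_
  rw [← Real.exp_log (show 0 < A₁ by linarith), ← Real.exp_nat_mul, Real.log_exp]
  apply Real.exp_le_exp.2
  have h3 : (3 : ℝ) ^ n ≤ (Y / z.im) ^ M := by
    calc (3 : ℝ) ^ n ≤ (((1 - η)⁻¹) ^ M) ^ n := by gcongr
      _ = (((1 - η)⁻¹) ^ n) ^ M := by rw [← pow_mul, ← pow_mul, mul_comm]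
      _ ≤ (Y / z.im) ^ M := by
        gcongr
        rw [inv_pow, show Y / z.im = (z.im / Y)⁻¹ by rw [inv_div]]
        exact inv_anti₀ (by positivity) hn2
  push_cast
  rw [pow_succ]
  calc (3 : ℝ) ^ n * 3 * Real.log A₁ ≤ (Y / z.im) ^ M * 3 * Real.log A₁ := by gcongr
    _ = _ := by rw [div_pow]; ring

/-- the bound across the real line -/
lemma star_lemma (ε Y₁ x₁ Y₂ x₂ A : ℝ) (hε : 0 < ε) (hY₁ : 0 < Y₁) (hY₁ε : Y₁ < ε / 4)
    (hx₁ : |x₁| ≤ ε / 4) (hY₂ : 0 < Y₂) (hY₂ε : Y₂ < ε / 4) (hx₂ : |x₂| ≤ ε / 4) (hA : 3 ≤ A) :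
    ∃ s > 0, ∃ C : ℝ, ∀ ψ : ℂ → ℂ, DifferentiableOn ℂ ψ (ball 0 ε) →
      (∀ z ∈ ball (0 : ℂ) ε, z.im ≠ 0 → ψ z ≠ 0 ∧ ψ z ≠ 1) →
      ‖ψ (x₁ + Y₁ * Complex.I)‖ ≤ A → ‖ψ (x₂ - Y₂ * Complex.I)‖ ≤ A →
      ∀ z ∈ ball (0 : ℂ) s, ‖ψ z‖ ≤ C := by
  obtain ⟨η, hη⟩ := omit_step
  obtain ⟨M, hM, hV⟩ := vert_growth hη
  obtain ⟨C₁, hC₁, h1⟩ := hV ε Y₁ x₁ A hε hY₁ hY₁ε hx₁ hA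
  obtain ⟨C₂, hC₂, h2⟩ := hV ε Y₂ (-x₂) A hε hY₂ hY₂ε (by rwa [abs_neg]) hA
  obtain ⟨s, hs, C, hC⟩ := rhombus M hM (C₁ + C₂) (ε / 4) (min Y₁ Y₂) (by positivity) (by positivity)
    (by positivity)
  refine ⟨s, hs, C, ?_⟩
  intro ψ hd ho hq1 hq2
  apply hC ψ (hd.mono (ball_subset_ball (by linarith)))
  intro z hzx hz0 hzY
  have g1 := h1 ψ hd (fun z hz h => ho z hz h.ne') hq1
  have g2 := h2 (fun z => ψ (-z)) (hd.comp (by fun_prop) (fun z hz => by simpa using hz))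
    (fun z hz h => ho (-z) (by simpa using hz) (by simpa using h.ne')) (by
      convert! hq2 using 3; push_cast; ring)
  rcases abs_cases z.im with ⟨h, h'⟩ | ⟨h, h'⟩
  · rw [h] at hz0 hzY ⊢
    refine (g1 z hzx hz0 (hzY.trans (min_le_left _ _))).trans (Real.exp_le_exp.2 ?_)
    gcongr; linarith
  · rw [h] at hz0 hzY ⊢
    have := g2 (-z) (by simpa using hzx) (by simpa using hz0)
      (by simpa using hzY.trans (min_le_right _ _))
    simp only [neg_neg, Complex.neg_im] at this
    refine this.trans (Real.exp_le_exp.2 ?_)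
    gcongr; linarith


lemma hasSum_coef {g : ℂ → ℂ} (hg : Differentiable ℂ g) (z : ℂ) :
    HasSum (fun k : ℕ => ((k.factorial : ℂ)⁻¹ * iteratedDeriv k g 0) * z ^ k) (g z) := by
  have := Complex.hasSum_taylorSeries_of_entire hg 0 z
  convert! this using 2 with k
  simp; ring

lemma coef_bound {g : ℂ → ℂ} (hg : Differentiable ℂ g) {r B : ℝ} (hr : 0 < r)
    (hB : ∀ z : ℂ, ‖z‖ = r → ‖g z‖ ≤ B) (k : ℕ) :
    ‖(k.factorial : ℂ)⁻¹ * iteratedDeriv k g 0‖ ≤ B / r ^ k := by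
  have := Complex.norm_iteratedDeriv_le_of_forall_mem_sphere_norm_le k hr (c := 0)
    hg.diffContOnCl (fun z hz => hB z (by simpa using hz))
  rw [norm_mul, norm_inv, RCLike.norm_natCast]
  have hk : (0 : ℝ) < k.factorial := by exact_mod_cast k.factorial_pos
  rw [inv_mul_le_iff₀ hk]
  refine this.trans (le_of_eq ?_); ring

lemma poly_of_growth {g : ℂ → ℂ} (hg : Differentiable ℂ g) (C : ℝ) (K : ℕ)
    (h : ∀ R : ℝ, ∃ r ≥ R, ∀ z : ℂ, ‖z‖ = r → ‖g z‖ ≤ C * r ^ K) :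
    ∃ p : Polynomial ℂ, ∀ z : ℂ, g z = p.eval z := by
  set a : ℕ → ℂ := fun k => (k.factorial : ℂ)⁻¹ * iteratedDeriv k g 0 with ha
  have hzero : ∀ k, K < k → a k = 0 := by
    intro k hk
    by_contra hne
    have hpos : 0 < ‖a k‖ := norm_pos_iff.2 hne
    obtain ⟨r, hr, hb⟩ := h (max 1 ((|C| + 1) / ‖a k‖))
    have hr1 : 1 ≤ r := (le_max_left _ _).trans hr
    have hr2 : (|C| + 1) / ‖a k‖ ≤ r := (le_max_right _ _).trans hr
    have h1 := coef_bound hg (by linarith) hb k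
    have h2 : C * r ^ K / r ^ k ≤ |C| / r := by
      rw [div_le_div_iff₀ (by positivity) (by positivity)]
      have h3 : r ^ K * r ≤ r ^ k := by
        rw [← pow_succ]; exact pow_le_pow_right₀ hr1 hk
      have h4 := le_abs_self C
      have h5 : 0 < r ^ K * r := by positivity
      calc C * r ^ K * r = C * (r ^ K * r) := by ring
        _ ≤ |C| * (r ^ K * r) := by gcongr
        _ ≤ |C| * r ^ k := by gcongr
    have h6 : ‖a k‖ ≤ |C| / r := h1.trans h2
    rw [le_div_iff₀ (by linarith)] at h6
    rw [div_le_iff₀ hpos] at hr2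
    linarith
  refine ⟨∑ k ∈ Finset.range (K + 1), Polynomial.monomial k (a k), fun z => ?_⟩
  have h1 := hasSum_coef hg z
  have h2 : HasSum (fun k : ℕ => a k * z ^ k) (∑ k ∈ Finset.range (K + 1), a k * z ^ k) := by
    apply hasSum_sum_of_ne_finset_zero
    intro k hk
    rw [hzero k (by simpa using hk), zero_mul]
  rw [h1.unique h2, Polynomial.eval_finsetSum]
  simp

lemma small_values {f : ℂ → ℂ} (hf : Differentiable ℂ f)
    (ht : ¬ ∃ p : Polynomial ℂ, ∀ z : ℂ, f z = p.eval z) (R : ℝ) : ∃ w : ℂ, R ≤ ‖w‖ ∧ ‖f w‖ ≤ 1 := by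
  by_contra hcon
  push Not at hcon
  apply ht
  set R' := max R 1 with hR'
  have hR'1 : 1 ≤ R' := le_max_right _ _
  have hcon' : ∀ w : ℂ, R' ≤ ‖w‖ → 1 < ‖f w‖ := fun w hw => hcon w ((le_max_left _ _).trans hw)
  set h : ℂ → ℂ := fun z => (f z⁻¹)⁻¹ with hh
  set s : Set ℂ := ball 0 (R'⁻¹) with hs
  have hs0 : s ∈ 𝓝 (0 : ℂ) := ball_mem_nhds _ (by positivity)
  have hinv : ∀ z ∈ s \ {0}, R' ≤ ‖z⁻¹‖ := by
    rintro z ⟨hz, hz0⟩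
    have h1 : ‖z‖ < R'⁻¹ := by simpa [hs] using hz
    have h2 : 0 < ‖z‖ := norm_pos_iff.2 hz0
    rw [norm_inv, le_inv_comm₀ (by positivity) h2]; exact h1.le
  have hd : DifferentiableOn ℂ h (s \ {0}) := by
    intro z hz
    apply DifferentiableAt.differentiableWithinAt
    have h1 : DifferentiableAt ℂ (fun z : ℂ => f z⁻¹) z :=
      (hf _).comp z (differentiableAt_inv hz.2)
    apply h1.inv
    intro h0
    have := hcon' _ (hinv z hz)
    rw [h0] at this; norm_num at this
  have hle : ∀ z ∈ s \ {0}, ‖h z‖ ≤ 1 := by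
    intro z hz
    rw [hh]; simp only [norm_inv]
    exact inv_le_one_of_one_le₀ (hcon' _ (hinv z hz)).le
  have hU := Complex.differentiableOn_update_limUnder_of_bddAbove hs0 hd ⟨1, by
    rintro _ ⟨z, hz, rfl⟩
    exact hle z hz⟩
  set H := Function.update h 0 (limUnder (𝓝[≠] 0) h) with hH
  have hHe : ∀ z, z ≠ 0 → H z = h z := fun z hz => Function.update_of_ne hz _ _
  have hA : AnalyticAt ℂ H 0 := hU.analyticAt hs0
  have hnz : ¬ ∀ᶠ z in 𝓝 (0 : ℂ), H z = 0 := by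
    intro hev
    have e1 : ∀ᶠ z in 𝓝[≠] (0 : ℂ), z ∈ s := mem_nhdsWithin_of_mem_nhds hs0
    have e2 : ∀ᶠ z in 𝓝[≠] (0 : ℂ), z ∈ ({0}ᶜ : Set ℂ) := self_mem_nhdsWithin
    have e3 : ∀ᶠ z in 𝓝[≠] (0 : ℂ), H z = 0 := hev.filter_mono nhdsWithin_le_nhds
    obtain ⟨z, hz, hzs, hz0⟩ := (e3.and (e1.and e2)).exists
    rw [hHe z hz0, hh] at hz
    simp only [inv_eq_zero] at hz
    have := hcon' _ (hinv z ⟨hzs, hz0⟩)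
    rw [hz] at this; norm_num at this
  obtain ⟨n, G, hG, hG0, hGe⟩ := hA.exists_eventuallyEq_pow_smul_nonzero_iff.2 hnz
  have hG' : ∀ᶠ z in 𝓝 (0 : ℂ), ‖G 0‖ / 2 < ‖G z‖ :=
    hG.continuousAt.norm.eventually_const_lt (by linarith [norm_pos_iff.2 hG0])
  obtain ⟨δ, hδ, hδb⟩ := Metric.eventually_nhds_iff.1 (hGe.and (hG'.and hs0))
  apply poly_of_growth hf (2 / ‖G 0‖) n
  intro R₁
  refine ⟨max R₁ (2 / δ), le_max_left _ _, ?_⟩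
  intro w hw
  have hwpos : 0 < ‖w‖ := by rw [hw]; exact lt_of_lt_of_le (by positivity) (le_max_right _ _)
  have hw0 : w ≠ 0 := norm_pos_iff.1 hwpos
  obtain ⟨e1, e2, e3⟩ := hδb (y := w⁻¹) (by
    rw [dist_zero_right, norm_inv, inv_lt_comm₀ hwpos hδ, hw]
    refine lt_of_lt_of_le ?_ (le_max_right _ _)
    rw [inv_eq_one_div]; gcongr; norm_num)
  rw [hHe _ (inv_ne_zero hw0), hh] at e1
  simp only [inv_inv, sub_zero, smul_eq_mul] at e1
  have hG0' := norm_pos_iff.2 hG0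
  have hGw : 0 < ‖G w⁻¹‖ := by linarith
  have : ‖f w‖ = ‖w‖ ^ n / ‖G w⁻¹‖ := by
    rw [← inv_inv (f w), e1, norm_inv, norm_mul, norm_pow, norm_inv]
    rw [mul_inv, inv_pow, inv_inv]; rfl
  rw [this, ← hw]
  rw [div_le_iff₀ hGw]
  calc ‖w‖ ^ n = (2 / ‖G 0‖ * ‖w‖ ^ n) * (‖G 0‖ / 2) := by field_simp
    _ ≤ _ := by gcongr

lemma growth_ratio {g : ℂ → ℂ} (hg : Differentiable ℂ g)
    (ht : ¬ ∃ p : Polynomial ℂ, ∀ z : ℂ, g z = p.eval z) {ρ C : ℝ} (hρ : 1 < ρ) (hC : 0 < C) :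
    ∃ R₀ : ℝ, ∀ r ≥ R₀, ∀ m > 0, (∃ z : ℂ, ‖z‖ ≤ r ∧ m ≤ ‖g z‖) →
      ∃ z : ℂ, ‖z‖ ≤ ρ * r ∧ C * m < ‖g z‖ := by
  by_contra hcon
  push Not at hcon
  apply ht
  set a : ℕ → ℂ := fun k => (k.factorial : ℂ)⁻¹ * iteratedDeriv k g 0 with ha
  have hρ1 : ρ⁻¹ < 1 := inv_lt_one_of_one_lt₀ hρ
  have hρ0 : 0 < ρ⁻¹ := by positivity
  obtain ⟨K, hK⟩ : ∃ K : ℕ, (ρ⁻¹) ^ K < (1 - ρ⁻¹) / (2 * C) :=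
    exists_pow_lt_of_lt_one (by have : 0 < 1 - ρ⁻¹ := by linarith
                                positivity) hρ1
  set C₁ := ∑ k ∈ Finset.range K, ‖a k‖ with hC₁
  apply poly_of_growth hg (C * (2 * C₁)) K
  intro R
  obtain ⟨r, hr, m, hm, ⟨z, hzr, hzm⟩, hb⟩ := hcon (max R 1)
  have hr1 : 1 ≤ r := (le_max_right _ _).trans hr
  refine ⟨r, (le_max_left _ _).trans hr, ?_⟩
  have hcoef : ∀ k, ‖a k‖ ≤ C * m / (ρ * r) ^ k :=
    coef_bound hg (by positivity) (fun z hz => hb z hz.le)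
  have hterm : ∀ k, ‖a k * z ^ k‖ ≤ C * m * (ρ⁻¹) ^ k := by
    intro k
    rw [norm_mul, norm_pow]
    calc ‖a k‖ * ‖z‖ ^ k ≤ (C * m / (ρ * r) ^ k) * r ^ k := by gcongr; exact hcoef k
      _ = C * m * (ρ⁻¹) ^ k := by
        rw [mul_pow, inv_pow]; field_simp
  have hsum := hasSum_coef hg z
  have htail := (hasSum_nat_add_iff' K).2 hsum
  have hgeo : HasSum (fun k : ℕ => C * m * (ρ⁻¹) ^ K * (ρ⁻¹) ^ k) (C * m * (ρ⁻¹) ^ K * (1 - ρ⁻¹)⁻¹) :=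
    (hasSum_geometric_of_lt_one hρ0.le hρ1).mul_left _
  have htb := htail.norm_le_of_bounded hgeo (by
    intro k
    refine (hterm (k + K)).trans (le_of_eq ?_)
    rw [pow_add]; ring)
  have h1 : C * m * (ρ⁻¹) ^ K * (1 - ρ⁻¹)⁻¹ ≤ m / 2 := by
    have hp : 0 < 1 - ρ⁻¹ := by linarith
    rw [← div_eq_mul_inv, div_le_iff₀ hp]
    rw [lt_div_iff₀ (by positivity)] at hK
    nlinarith
  have h2 : ‖∑ k ∈ Finset.range K, a k * z ^ k‖ ≤ C₁ * r ^ K := by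
    rw [hC₁, Finset.sum_mul]
    refine norm_sum_le_of_le _ ?_
    intro k hk
    rw [norm_mul, norm_pow]
    have : ‖z‖ ^ k ≤ r ^ K := calc
      ‖z‖ ^ k ≤ r ^ k := by gcongr
      _ ≤ r ^ K := pow_le_pow_right₀ hr1 (Finset.mem_range.1 hk).le
    gcongr
  have h3 : m ≤ 2 * (C₁ * r ^ K) := by
    have := norm_le_norm_add_norm_sub' (g z) (∑ k ∈ Finset.range K, a k * z ^ k)
    linarith
  intro w hw
  refine (hb w (by rw [hw]; nlinarith)).trans ?_
  calc C * m ≤ C * (2 * (C₁ * r ^ K)) := by gcongr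
    _ = _ := by ring


def Bd (l : Ultrafilter ℕ) (g : ℕ → ℂ → ℂ) (z : ℂ) : Prop :=
  ∃ ε > 0, ∃ C : ℝ, ∀ᶠ n in (l : Filter ℕ), ∀ w ∈ ball z ε, ‖g n w‖ ≤ C

def Br (l : Ultrafilter ℕ) (g : ℕ → ℂ → ℂ) (z₀ : ℂ) : Prop :=
  ∃ ε > 0, ∀ᶠ n in (l : Filter ℕ), ∃ ψ : ℂ → ℂ, DifferentiableOn ℂ ψ (ball z₀ ε) ∧
    ∀ z ∈ ball z₀ ε, (z.im ≠ 0 → ψ z ≠ 0 ∧ ψ z ≠ 1) ∧ ‖ψ z‖ ≤ 4 * (‖g n z‖ + 2) ∧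
      ‖g n z‖ ≤ 4 * ‖ψ z‖ + 2

lemma Bd.isOpen (l : Ultrafilter ℕ) (g : ℕ → ℂ → ℂ) : IsOpen {z | Bd l g z} := by
  rw [Metric.isOpen_iff]
  rintro z ⟨ε, hε, C, h⟩
  refine ⟨ε / 2, by positivity, ?_⟩
  intro w hw
  refine ⟨ε / 2, by positivity, C, ?_⟩
  filter_upwards [h] with n hn v hv
  apply hn
  rw [mem_ball] at *
  linarith [dist_triangle v w z]

lemma bd_step {l : Ultrafilter ℕ} {g : ℕ → ℂ → ℂ} {z₀ : ℂ} (hb : Br l g z₀) (him : z₀.im ≠ 0) :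
    ∃ ε₀ > 0, ∀ q ∈ ball z₀ ε₀, Bd l g q → Bd l g z₀ := by
  obtain ⟨η, hη⟩ := omit_step
  obtain ⟨hη0, hη1, hst⟩ := hη
  obtain ⟨ε, hε, hb⟩ := hb
  have him' : 0 < |z₀.im| := abs_pos.2 him
  set r := min ε |z₀.im| / 2 with hr
  have hr0 : 0 < r := by positivity
  have hrε : 2 * r ≤ ε := by rw [hr]; linarith [min_le_left ε |z₀.im|]
  have hri : 2 * r ≤ |z₀.im| := by rw [hr]; linarith [min_le_right ε |z₀.im|]
  refine ⟨η * r / 2, by positivity, ?_⟩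
  rintro q hq ⟨δ, hδ, C, hC⟩
  refine ⟨η * r / 2, by positivity, 4 * (max 3 (4 * (C + 2))) ^ 3 + 2, ?_⟩
  filter_upwards [hb, hC] with n hn hCn v hv
  obtain ⟨ψ, hψ, hψ2⟩ := hn
  have hηr : η * r ≤ r / 4 := by nlinarith
  have hsub : ball q r ⊆ ball z₀ (2 * r) := by
    apply ball_subset_ball'
    rw [mem_ball] at hq; linarith
  have hvr : v ∈ ball z₀ ε := by
    apply ball_subset_ball _ hv; linarith
  have h1 := hst ψ q v r (max 3 (4 * (C + 2))) hr0
    (hψ.mono (hsub.trans (ball_subset_ball hrε))) (by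
      intro z hz
      have hz2 := hsub hz
      apply (hψ2 z (ball_subset_ball hrε hz2)).1
      intro h0
      rw [mem_ball, Complex.dist_eq] at hz2
      have := Complex.abs_im_le_norm (z - z₀)
      rw [Complex.sub_im, h0, zero_sub, abs_neg] at this
      linarith) (le_max_left _ _) (by
      refine le_trans ?_ (le_max_right _ _)
      have := (hψ2 q (ball_subset_ball (by linarith) hq)).2.1
      have h2 := hCn q (mem_ball_self hδ)
      linarith) (by
      rw [← dist_eq_norm]
      rw [mem_ball] at hv hq
      linarith [dist_triangle v z₀ q, dist_comm q z₀])
  have := (hψ2 v hvr).2.2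
  linarith

lemma bd_conn {l : Ultrafilter ℕ} {g : ℕ → ℂ → ℂ} {S : Set ℂ} (hS : IsPreconnected S)
    (hb : ∀ z ∈ S, Br l g z ∧ z.im ≠ 0) (hne : ∃ p ∈ S, Bd l g p) : ∀ z ∈ S, Bd l g z := by
  have : S ⊆ {z | Bd l g z} := by
    apply hS.subset_of_closure_inter_subset (Bd.isOpen l g)
    · obtain ⟨p, hp, hp2⟩ := hne
      exact ⟨p, hp, hp2⟩
    · rintro z ⟨hz, hzS⟩
      obtain ⟨ε₀, hε₀, h⟩ := bd_step (hb z hzS).1 (hb z hzS).2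
      obtain ⟨q, hq, hqd⟩ := Metric.mem_closure_iff.1 hz ε₀ hε₀
      exact h q (by rw [mem_ball, dist_comm]; exact hqd) hq
  exact this

lemma bd_real {l : Ultrafilter ℕ} {g : ℕ → ℂ → ℂ} {x₀ : ℝ} (hb : Br l g x₀)
    (hu : ∀ ε > 0, ∃ z ∈ ball (x₀ : ℂ) ε, 0 < z.im ∧ Bd l g z)
    (hl : ∀ ε > 0, ∃ z ∈ ball (x₀ : ℂ) ε, z.im < 0 ∧ Bd l g z) : Bd l g x₀ := by
  obtain ⟨ε, hε, hb⟩ := hb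
  obtain ⟨z₁, hz₁, hi₁, δ₁, hδ₁, C₁, hC₁⟩ := hu (ε / 4) (by positivity)
  obtain ⟨z₂, hz₂, hi₂, δ₂, hδ₂, C₂, hC₂⟩ := hl (ε / 4) (by positivity)
  rw [mem_ball, Complex.dist_eq] at hz₁ hz₂
  have a1 := Complex.abs_im_le_norm (z₁ - x₀)
  have a2 := Complex.abs_re_le_norm (z₁ - x₀)
  have a3 := Complex.abs_im_le_norm (z₂ - x₀)
  have a4 := Complex.abs_re_le_norm (z₂ - x₀)
  simp only [Complex.sub_im, Complex.sub_re, Complex.ofReal_im, Complex.ofReal_re, sub_zero]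
    at a1 a2 a3 a4
  set A := max 3 (max (4 * (C₁ + 2)) (4 * (C₂ + 2))) with hA
  obtain ⟨s, hs, C, hC⟩ := star_lemma ε z₁.im (z₁.re - x₀) (-z₂.im) (z₂.re - x₀) A hε hi₁
    (by linarith [le_abs_self z₁.im]) (by linarith) (by linarith)
    (by linarith [neg_abs_le z₂.im]) (by linarith) (le_max_left _ _)
  refine ⟨min s ε, by positivity, 4 * C + 2, ?_⟩
  filter_upwards [hb, hC₁, hC₂] with n hn h1 h2 w hw
  obtain ⟨ψ, hψ, hψ2⟩ := hn
  have hmem : ∀ z ∈ ball (0 : ℂ) ε, z + x₀ ∈ ball (x₀ : ℂ) ε := by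
    intro z hz; rw [mem_ball, dist_eq_norm] at *; simpa using hz
  have e1 : (((z₁.re - x₀ : ℝ) : ℂ) + (z₁.im : ℝ) * Complex.I) + x₀ = z₁ := by
    apply Complex.ext <;> simp
  have e2 : (((z₂.re - x₀ : ℝ) : ℂ) - ((-z₂.im : ℝ) : ℂ) * Complex.I) + x₀ = z₂ := by
    apply Complex.ext <;> simp
  have hw' : w - x₀ ∈ ball (0 : ℂ) s := by
    rw [mem_ball, dist_zero_right, ← dist_eq_norm]
    exact lt_of_lt_of_le hw (min_le_left _ _)
  have := hC (fun z => ψ (z + x₀)) (by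
      apply hψ.comp (by fun_prop)
      exact hmem) (by
      intro z hz hzi
      apply (hψ2 _ (hmem z hz)).1
      simpa using hzi) (by
      show ‖ψ _‖ ≤ _
      rw [e1]
      have b1 := (hψ2 z₁ (by rw [mem_ball, Complex.dist_eq]; linarith)).2.1
      have b2 := h1 z₁ (mem_ball_self hδ₁)
      have b3 : 4 * (C₁ + 2) ≤ A := (le_max_left _ _).trans (le_max_right _ _)
      linarith) (by
      show ‖ψ _‖ ≤ _
      rw [e2]
      have b1 := (hψ2 z₂ (by rw [mem_ball, Complex.dist_eq]; linarith)).2.1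
      have b2 := h2 z₂ (mem_ball_self hδ₂)
      have b3 : 4 * (C₂ + 2) ≤ A := (le_max_right _ _).trans (le_max_right _ _)
      linarith) _ hw'
  simp only [sub_add_cancel] at this
  have h3 := (hψ2 w (ball_subset_ball (min_le_right _ _) hw)).2.2
  linarith

lemma arc_bd {l : Ultrafilter ℕ} {g : ℕ → ℂ → ℂ} {E : Set ℂ} (hE : E.Countable)
    (hBr : ∀ z ∉ E, 1 / 2 < ‖z‖ → Br l g z) (h34 : ∀ z : ℂ, ‖z‖ < 1 → Bd l g z)
    {ρ : ℝ} (hρ : 1 < ρ) (hρE : ∀ e ∈ E, ‖e‖ ≠ ρ) {a b : ℝ} (hab : a < b) (ha : -Real.pi ≤ a)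
    (hb : b ≤ Real.pi) (hsin : ∀ θ ∈ Ioo a b, Real.sin θ ≠ 0) :
    ∀ z ∈ (fun θ : ℝ => (ρ : ℂ) * Complex.exp (θ * Complex.I)) '' Ioo a b, Bd l g z := by
  obtain ⟨α, hα, hαab⟩ : ∃ α ∈ (Complex.arg '' E)ᶜ, α ∈ Ioo a b := by
    have := (hE.image Complex.arg).dense_compl ℝ
    exact this.exists_mem_open isOpen_Ioo (nonempty_Ioo.2 hab)
  have him : ∀ t θ : ℝ, ((t : ℂ) * Complex.exp (θ * Complex.I)).im = t * Real.sin θ := by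
    intro t θ
    rw [Complex.im_ofReal_mul, Complex.exp_ofReal_mul_I_im]
  have hno : ∀ t θ : ℝ, 0 < t → ‖((t : ℂ) * Complex.exp (θ * Complex.I))‖ = t := by
    intro t θ ht
    rw [norm_mul, Complex.norm_exp_ofReal_mul_I, mul_one, Complex.norm_real,
      Real.norm_of_nonneg ht.le]
  have ray : ∀ z ∈ (fun t : ℝ => (t : ℂ) * Complex.exp (α * Complex.I)) '' Icc (3 / 4) ρ,
      Bd l g z := by
    apply bd_conn
    · apply isPreconnected_Icc.image
      fun_prop
    · rintro _ ⟨t, ht, rfl⟩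
      have ht0 : 0 < t := by linarith [ht.1]
      refine ⟨hBr _ ?_ ?_, ?_⟩
      · intro he
        apply hα
        refine ⟨_, he, ?_⟩
        simp only
        rw [Complex.arg_real_mul _ ht0, Complex.arg_exp_mul_I, toIocMod_eq_self]
        constructor <;> linarith [hαab.1, hαab.2]
      · rw [hno _ _ ht0]; linarith [ht.1]
      · rw [him]; exact mul_ne_zero ht0.ne' (hsin α hαab)
    · refine ⟨_, ⟨3 / 4, ⟨le_rfl, by linarith⟩, rfl⟩, ?_⟩
      apply h34
      rw [hno _ _ (by norm_num)]; norm_num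
  apply bd_conn
  · apply isPreconnected_Ioo.image
    fun_prop
  · rintro _ ⟨θ, hθ, rfl⟩
    refine ⟨hBr _ ?_ ?_, ?_⟩
    · intro he
      exact hρE _ he (hno _ _ (by linarith))
    · rw [hno _ _ (by linarith)]; linarith
    · rw [him]; exact mul_ne_zero (by linarith) (hsin θ hθ)
  · exact ⟨_, ⟨α, hαab, rfl⟩, ray _ ⟨ρ, ⟨by linarith, le_rfl⟩, rfl⟩⟩

lemma main_top {l : Ultrafilter ℕ} {g : ℕ → ℂ → ℂ} (hg : ∀ n, Differentiable ℂ (g n))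
    {E : Set ℂ} (hE : E.Countable)
    (hBr : ∀ z ∉ E, 1 / 2 < ‖z‖ → Br l g z)
    (h1 : ∀ᶠ n in (l : Filter ℕ), ∀ z : ℂ, ‖z‖ < 1 → ‖g n z‖ ≤ 1) :
    ∃ ρ > 1, ∃ C : ℝ, ∀ᶠ n in (l : Filter ℕ), ∀ z : ℂ, ‖z‖ ≤ ρ → ‖g n z‖ ≤ C := by
  have h34 : ∀ z : ℂ, ‖z‖ < 1 → Bd l g z := by
    intro z hz
    refine ⟨1 - ‖z‖, by linarith, 1, ?_⟩
    filter_upwards [h1] with n hn w hw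
    apply hn
    rw [mem_ball, dist_eq_norm] at hw
    linarith [norm_sub_norm_le w z]
  obtain ⟨ρ, hρE', hρ, hρ2⟩ : ∃ ρ ∈ ((fun z : ℂ => ‖z‖) '' E)ᶜ, ρ ∈ Ioo (1 : ℝ) 2 := by
    have := (hE.image (fun z : ℂ => ‖z‖)).dense_compl ℝ
    exact this.exists_mem_open isOpen_Ioo (nonempty_Ioo.2 (by norm_num))
  have hρE : ∀ e ∈ E, ‖e‖ ≠ ρ := fun e he h => hρE' ⟨e, he, h⟩
  have hρ0 : 0 < ρ := by linarith
  have hpi := Real.pi_pos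
  set F : ℝ → ℂ := fun θ : ℝ => (ρ : ℂ) * Complex.exp (θ * Complex.I) with hF
  have hFc : Continuous F := by fun_prop
  have hFim : ∀ θ, (F θ).im = ρ * Real.sin θ := by
    intro θ; simp [hF, Complex.exp_ofReal_mul_I_im]
  have up : ∀ z ∈ F '' Ioo 0 Real.pi, Bd l g z :=
    arc_bd hE hBr h34 hρ hρE hpi (by linarith) le_rfl
      (fun θ hθ => (Real.sin_pos_of_mem_Ioo hθ).ne')
  have lo : ∀ z ∈ F '' Ioo (-Real.pi) 0, Bd l g z :=
    arc_bd hE hBr h34 hρ hρE (by linarith) le_rfl hpi.le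
      (fun θ hθ => (Real.sin_neg_of_neg_of_neg_pi_lt hθ.2 hθ.1).ne)
  have cl : ∀ (a b c : ℝ), c ∈ Icc a b → a < b → ∀ ε > 0, ∃ θ ∈ Ioo a b, F θ ∈ ball (F c) ε := by
    intro a b c hc hab ε hε
    rw [← closure_Ioo hab.ne] at hc
    have := image_closure_subset_closure_image hFc (mem_image_of_mem F hc)
    obtain ⟨_, ⟨θ, hθ, rfl⟩, hd⟩ := Metric.mem_closure_iff.1 this ε hε
    exact ⟨θ, hθ, by rw [mem_ball, dist_comm]; exact hd⟩
  have F0 : F 0 = (ρ : ℝ) := by simp [hF]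
  have Fpi : F Real.pi = ((-ρ : ℝ) : ℂ) := by simp [hF]
  have Fmpi : F (-Real.pi) = ((-ρ : ℝ) : ℂ) := by simp [hF, Complex.exp_neg]
  have real : ∀ x : ℝ, |x| = ρ → ∀ c d : ℝ, c ∈ Icc 0 Real.pi → d ∈ Icc (-Real.pi) 0 →
      F c = x → F d = x → Bd l g x := by
    intro x hx c d hc hd hFx hFd
    apply bd_real
    · apply hBr
      · intro he
        apply hρE _ he
        rw [Complex.norm_real, Real.norm_eq_abs, hx]
      · rw [Complex.norm_real, Real.norm_eq_abs, hx]; linarith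
    · intro ε hε
      obtain ⟨θ, hθ, hb⟩ := cl 0 Real.pi c hc hpi ε hε
      rw [hFx] at hb
      refine ⟨_, hb, ?_, up _ ⟨θ, hθ, rfl⟩⟩
      rw [hFim]; exact mul_pos hρ0 (Real.sin_pos_of_mem_Ioo hθ)
    · intro ε hε
      obtain ⟨θ, hθ, hb⟩ := cl (-Real.pi) 0 d hd (by linarith) ε hε
      rw [hFd] at hb
      refine ⟨_, hb, ?_, lo _ ⟨θ, hθ, rfl⟩⟩
      rw [hFim]; exact mul_neg_of_pos_of_neg hρ0 (Real.sin_neg_of_neg_of_neg_pi_lt hθ.2 hθ.1)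
  have hall : ∀ z ∈ sphere (0 : ℂ) ρ, Bd l g z := by
    intro z hz
    have hz' : ‖z‖ = ρ := by simpa using hz
    have hFz : F z.arg = z := by
      rw [hF]; simp only; rw [← hz']; exact Complex.norm_mul_exp_arg_mul_I z
    rcases lt_trichotomy z.arg 0 with h | h | h
    · exact lo z ⟨z.arg, ⟨Complex.neg_pi_lt_arg z, h⟩, hFz⟩
    · rw [h, F0] at hFz
      rw [← hFz]
      exact real ρ (abs_of_pos hρ0) 0 0 ⟨le_rfl, hpi.le⟩ ⟨by linarith, le_rfl⟩ F0 F0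
    · rcases (Complex.arg_le_pi z).lt_or_eq with h2 | h2
      · exact up z ⟨z.arg, ⟨h, h2⟩, hFz⟩
      · rw [h2, Fpi] at hFz
        rw [← hFz]
        exact real (-ρ) (by rw [abs_neg, abs_of_pos hρ0]) Real.pi (-Real.pi) ⟨hpi.le, le_rfl⟩
          ⟨le_rfl, by linarith⟩ Fpi Fmpi
  have hcomp : ∃ C : ℝ, ∀ᶠ n in (l : Filter ℕ), ∀ w ∈ sphere (0 : ℂ) ρ, ‖g n w‖ ≤ C := by
    apply (isCompact_sphere (0 : ℂ) ρ).induction_on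
      (p := fun s => ∃ C : ℝ, ∀ᶠ n in (l : Filter ℕ), ∀ w ∈ s, ‖g n w‖ ≤ C)
    · exact ⟨0, by simp⟩
    · rintro s t hst ⟨C, hC⟩
      exact ⟨C, hC.mono fun n hn w hw => hn w (hst hw)⟩
    · rintro s t ⟨C, hC⟩ ⟨D, hD⟩
      refine ⟨max C D, ?_⟩
      filter_upwards [hC, hD] with n h1 h2 w hw
      rcases hw with hw | hw
      · exact (h1 w hw).trans (le_max_left _ _)
      · exact (h2 w hw).trans (le_max_right _ _)
    · intro z hz
      obtain ⟨ε, hε, C, hC⟩ := hall z hz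
      exact ⟨ball z ε, mem_nhdsWithin_of_mem_nhds (ball_mem_nhds z hε), C, hC⟩
  obtain ⟨C, hC⟩ := hcomp
  refine ⟨ρ, hρ, C, ?_⟩
  filter_upwards [hC] with n hn z hz
  apply Complex.norm_le_of_forall_mem_frontier_norm_le (U := ball 0 ρ) isBounded_ball
    (hg n).diffContOnCl
  · intro w hw
    rw [frontier_ball _ hρ0.ne'] at hw
    exact hn w hw
  · rw [closure_ball _ hρ0.ne']; simpa using hz


lemma exists_argmax {f : ℕ → ℂ → ℂ} (hf : ∀ n, Differentiable ℂ (f n)) {l : Ultrafilter ℕ}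
    {S : Set ℂ} (hS : IsCompact S) (hne : S.Nonempty)
    (hu : ∀ K : ℝ, 1 ≤ K → ¬ ∀ᶠ n in (l : Filter ℕ), ∀ z ∈ S, sph (f n) z ≤ K) :
    ∃ v : ℕ → ℂ, (∀ n, v n ∈ S) ∧ Tendsto (fun n => sph (f n) (v n)) (l : Filter ℕ) atTop := by
  have h : ∀ n, ∃ v ∈ S, ∀ z ∈ S, sph (f n) z ≤ sph (f n) v := by
    intro n
    have hc : ContinuousOn (sph (f n)) S :=
      (sph_continuousOn isOpen_univ (hf n).differentiableOn).mono (subset_univ _)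
    obtain ⟨v, hv, hm⟩ := hS.exists_isMaxOn hne hc
    exact ⟨v, hv, fun z hz => hm hz⟩
  choose v hv hm using h
  refine ⟨v, hv, ?_⟩
  rw [Filter.tendsto_atTop]
  intro K
  by_contra hcon
  rw [← Ultrafilter.eventually_not] at hcon
  apply hu (max K 1) (le_max_right _ _)
  filter_upwards [hcon] with n hn z hz
  exact ((hm n z hz).trans (not_le.1 hn).le).trans (le_max_left _ _)

lemma circle_chain {f : ℂ → ℂ} (hf : Differentiable ℂ f) {K : ℝ} (hK1 : 1 ≤ K)
    (hK : ∀ z ∈ {z : ℂ | 7 / 8 ≤ ‖z‖ ∧ ‖z‖ ≤ 9 / 8}, sph f z ≤ K) {N : ℕ} (hN : 0 < N)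
    (hNK : Real.pi * (40 * K) ≤ N) {β w : ℂ} (hβ : ‖β‖ = 1) (hw : ‖w‖ = 1) (hfβ : ‖f β‖ ≤ 1) :
    ‖f w‖ ≤ 3 ^ (3 ^ N) := by
  set θ := (w / β).arg with hθ
  have hβ0 : β ≠ 0 := by rw [← norm_ne_zero_iff, hβ]; norm_num
  have hwβ : Complex.exp (θ * Complex.I) = w / β := by
    have := Complex.norm_mul_exp_arg_mul_I (w / β)
    rw [norm_div, hβ, hw] at this
    simpa using this
  have hN' : (0 : ℝ) < N := by exact_mod_cast hN
  have hno : ∀ t : ℝ, ‖β * Complex.exp (t * Complex.I)‖ = 1 := by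
    intro t; rw [norm_mul, hβ, Complex.norm_exp_ofReal_mul_I, one_mul]
  have key : ∀ j : ℕ, ‖f (β * Complex.exp (((θ * j / N : ℝ) : ℂ) * Complex.I))‖ ≤ 3 ^ (3 ^ j) := by
    intro j
    induction j with
    | zero => simp; linarith
    | succ j ih =>
      set u := β * Complex.exp (((θ * j / N : ℝ) : ℂ) * Complex.I) with hu
      have hu1 : ‖u‖ = 1 := hno _
      have := st_step (f := f) (u := u) (r := 1 / (10 * K)) (K := K) (A := 3 ^ 3 ^ j)
        (v := β * Complex.exp (((θ * (j + 1 : ℕ) / N : ℝ) : ℂ) * Complex.I))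
        hf.differentiableOn (by
          intro z hz
          apply hK
          have h1 : ‖z - u‖ < 1 / (10 * K) := by rwa [mem_ball, dist_eq_norm] at hz
          have h2 : 1 / (10 * K) ≤ 1 / 10 := by gcongr; linarith
          have h3 := norm_sub_norm_le z u
          have h4 := norm_sub_norm_le u z
          rw [norm_sub_rev] at h4
          constructor <;> linarith) (by positivity) (by
          apply le_of_eq; field_simp) (by
          calc (3 : ℝ) = 3 ^ 1 := by norm_num
            _ ≤ 3 ^ 3 ^ j := by
              apply pow_le_pow_right₀ (by norm_num); exact Nat.one_le_pow _ _ (by norm_num)) ih (by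
          have e : β * Complex.exp (((θ * (j + 1 : ℕ) / N : ℝ) : ℂ) * Complex.I) - u =
              u * (Complex.exp (Complex.I * ((θ / N : ℝ) : ℂ)) - 1) := by
            rw [hu, mul_sub, mul_assoc β, ← Complex.exp_add, mul_one]
            congr 3
            push_cast; field_simp
          rw [e, norm_mul, hu1, one_mul]
          refine (Real.norm_exp_I_mul_ofReal_sub_one_le).trans ?_
          rw [Real.norm_eq_abs, abs_div, abs_of_pos hN', div_le_iff₀ hN']
          have h5 : |θ| ≤ Real.pi := Complex.abs_arg_le_pi _
          calc |θ| ≤ Real.pi := h5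
            _ = 1 / (10 * K) / 2 * (Real.pi * (20 * K)) := by field_simp; norm_num
            _ ≤ 1 / (10 * K) / 2 * N := by
              gcongr
              nlinarith [Real.pi_pos])
      rw [pow_succ 3 j, pow_mul]
      exact this
  have := key N
  have e : θ * N / N = θ := by field_simp
  rw [e, hwβ, mul_div_cancel₀ _ hβ0] at this
  exact this

lemma core {l : Ultrafilter ℕ} {f g : ℕ → ℂ → ℂ} (hf : ∀ n, Differentiable ℂ (f n))
    (hg : ∀ n, Differentiable ℂ (g n))
    (h1 : ∀ᶠ n in (l : Filter ℕ), ∀ z : ℂ, ‖z‖ < 1 → ‖g n z‖ ≤ 1)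
    (h2 : ∀ ρ > 1, ∀ C : ℝ, ∀ᶠ n in (l : Filter ℕ), ∃ z : ℂ, ‖z‖ ≤ ρ ∧ C < ‖g n z‖)
    (h3 : ∀ᶠ n in (l : Filter ℕ), ‖f n 0‖ ≤ 1)
    (h4 : ∀ᶠ n in (l : Filter ℕ), ∃ β : ℂ, ‖β‖ = 1 ∧ ‖f n β‖ ≤ 1)
    (h5 : ∀ δ > 0, ∀ C : ℝ, ∀ᶠ n in (l : Filter ℕ), ∃ w : ℂ, ‖w‖ = δ ∧ C < ‖f n w‖)
    (h6 : ∀ᶠ n in (l : Filter ℕ), ∀ z : ℂ, 1 / 2 < ‖z‖ → f n (g n z) = z → z.im = 0) : False := by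
  obtain ⟨v, hv, hvt⟩ := exists_argmax hf (l := l) (isCompact_closedBall (0 : ℂ) (1 / 4))
    ⟨0, by simp⟩ (by
      intro K hK hcon
      obtain ⟨n, hn, h3n, w, hw, hwC⟩ := (hcon.and (h3.and
        (h5 (1 / (10 * K) / 2) (by positivity) 27))).exists
      have hr : 1 / (10 * K) ≤ 1 / 10 := by gcongr; linarith
      have := st_step (f := f n) (u := 0) (v := w) (r := 1 / (10 * K)) (K := K) (A := 3)
        (hf n).differentiableOn (by
          intro z hz
          apply hn
          rw [mem_ball] at hz; rw [mem_closedBall]; linarith) (by positivity)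
        (by apply le_of_eq; field_simp) le_rfl (by linarith) (by rw [sub_zero, hw])
      norm_num at this
      linarith)
  obtain ⟨v', hv', hvt'⟩ := exists_argmax hf (l := l)
    (S := {z : ℂ | 7 / 8 ≤ ‖z‖ ∧ ‖z‖ ≤ 9 / 8}) (by
      apply (isCompact_closedBall (0 : ℂ) (9 / 8)).of_isClosed_subset
      · exact (isClosed_le continuous_const continuous_norm).inter
          (isClosed_le continuous_norm continuous_const)
      · rintro z ⟨_, hz⟩; simpa using hz)
    ⟨1, by simp; norm_num⟩ (by
      intro K hK hcon
      obtain ⟨N, hN⟩ := exists_nat_ge (Real.pi * (40 * K))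
      have hN0 : 0 < N := by
        have : (0 : ℝ) < N := lt_of_lt_of_le (by have := Real.pi_pos; positivity) hN
        exact_mod_cast this
      obtain ⟨n, hn, ⟨β, hβ, hβ2⟩, w, hw, hwC⟩ := (hcon.and (h4.and
        (h5 1 one_pos (3 ^ (3 ^ N))))).exists
      exact absurd (circle_chain (hf n) hK hn hN0 hN hβ hw hβ2) (not_le.2 hwC))
  obtain ⟨E₀, hE₀, hB₀⟩ := branch_lemma l f hf v hvt (δ := 1 / 4) (by norm_num)
  obtain ⟨E₁, hE₁, hB₁⟩ := branch_lemma l f hf v' hvt' (δ := 1 / 8) (by norm_num)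
  have hBr : ∀ z ∉ E₀ ∪ E₁, 1 / 2 < ‖z‖ → Br l g z := by
    intro z₀ hz₀ hz₀n
    obtain ⟨ε₀, hε₀, H₀⟩ := hB₀ z₀ (fun h => hz₀ (Or.inl h))
    obtain ⟨ε₁, hε₁, H₁⟩ := hB₁ z₀ (fun h => hz₀ (Or.inr h))
    set ε := min (min ε₀ ε₁) (‖z₀‖ - 1 / 2) with hε
    have hεp : 0 < ε := lt_min (lt_min hε₀ hε₁) (by linarith)
    have s0 : ball z₀ ε ⊆ ball z₀ ε₀ := ball_subset_ball ((min_le_left _ _).trans (min_le_left _ _))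
    have s1 : ball z₀ ε ⊆ ball z₀ ε₁ := ball_subset_ball ((min_le_left _ _).trans (min_le_right _ _))
    refine ⟨ε, hεp, ?_⟩
    filter_upwards [H₀, H₁, h6] with n H0 H1 h6n
    obtain ⟨φ₀, d0, p0⟩ := H0
    obtain ⟨φ₁, d1, p1⟩ := H1
    have hn0 : ∀ z ∈ ball z₀ ε, ‖φ₀ z‖ ≤ 1 / 2 := by
      intro z hz
      have a1 := (p0 z (s0 hz)).2
      have a2 := hv n
      rw [mem_ball, dist_eq_norm] at a1
      rw [mem_closedBall, dist_zero_right] at a2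
      linarith [norm_sub_norm_le (φ₀ z) (v n)]
    have hn1 : ∀ z ∈ ball z₀ ε, 3 / 4 ≤ ‖φ₁ z‖ ∧ ‖φ₁ z‖ ≤ 5 / 4 := by
      intro z hz
      have a1 := (p1 z (s1 hz)).2
      obtain ⟨a2, a3⟩ := hv' n
      rw [mem_ball, dist_eq_norm] at a1
      have a4 := norm_sub_norm_le (φ₁ z) (v' n)
      have a5 := norm_sub_norm_le (v' n) (φ₁ z)
      rw [norm_sub_rev] at a5
      constructor <;> linarith
    have hd : ∀ z ∈ ball z₀ ε, 1 / 4 ≤ ‖φ₁ z - φ₀ z‖ ∧ ‖φ₁ z - φ₀ z‖ ≤ 7 / 4 := by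
      intro z hz
      have := hn0 z hz
      have := hn1 z hz
      constructor
      · linarith [norm_sub_norm_le (φ₁ z) (φ₀ z)]
      · linarith [norm_sub_le (φ₁ z) (φ₀ z)]
    have hdn : ∀ z ∈ ball z₀ ε, φ₁ z - φ₀ z ≠ 0 := by
      intro z hz h0
      have := (hd z hz).1
      rw [h0, norm_zero] at this; norm_num at this
    refine ⟨fun z => (g n z - φ₀ z) / (φ₁ z - φ₀ z), ?_, ?_⟩
    · exact ((hg n).differentiableOn.sub (d0.mono s0)).div ((d1.mono s1).sub (d0.mono s0)) hdn
    · intro z hz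
      have hz2 : 1 / 2 < ‖z‖ := by
        rw [mem_ball, dist_eq_norm] at hz
        have := min_le_right (min ε₀ ε₁) (‖z₀‖ - 1 / 2)
        have h := norm_sub_norm_le z₀ z
        rw [norm_sub_rev] at h
        linarith
      have hne := hdn z hz
      refine ⟨?_, ?_, ?_⟩
      · intro him
        constructor
        · intro h
          rcases div_eq_zero_iff.1 h with h | h
          · apply him; apply h6n z hz2
            rw [sub_eq_zero.1 h]; exact (p0 z (s0 hz)).1
          · exact hne h
        · intro h
          rw [div_eq_one_iff_eq hne] at h
          apply him; apply h6n z hz2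
          rw [sub_left_injective h]; exact (p1 z (s1 hz)).1
      · rw [norm_div, div_le_iff₀ (norm_pos_iff.2 hne)]
        have a1 := norm_sub_le (g n z) (φ₀ z)
        have a2 := hn0 z hz
        have a3 := (hd z hz).1
        nlinarith [norm_nonneg (g n z)]
      · have e : g n z = (g n z - φ₀ z) / (φ₁ z - φ₀ z) * (φ₁ z - φ₀ z) + φ₀ z := by
          rw [div_mul_cancel₀ _ hne]; ring
        have a2 := hn0 z hz
        have a3 := (hd z hz).2
        calc ‖g n z‖ = ‖(g n z - φ₀ z) / (φ₁ z - φ₀ z) * (φ₁ z - φ₀ z) + φ₀ z‖ := by rw [← e]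
          _ ≤ ‖(g n z - φ₀ z) / (φ₁ z - φ₀ z)‖ * ‖φ₁ z - φ₀ z‖ + ‖φ₀ z‖ := by
            rw [← norm_mul]; exact norm_add_le _ _
          _ ≤ ‖(g n z - φ₀ z) / (φ₁ z - φ₀ z)‖ * 4 + 2 := by gcongr <;> linarith
          _ = _ := by ring
  obtain ⟨ρ, hρ, C, hC⟩ := main_top hg (hE₀.union hE₁) hBr h1
  obtain ⟨n, hn, z, hz, hz2⟩ := (hC.and (h2 ρ hρ C)).exists
  exact absurd (hn z hz) (not_le.2 hz2)


lemma first_hit {g : ℂ → ℂ} (hg : Differentiable ℂ g)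
    (ht : ¬ ∃ p : Polynomial ℂ, ∀ z : ℂ, g z = p.eval z) (s : ℝ) :
    ∃ z : ℂ, s ≤ ‖g z‖ ∧ ∀ w : ℂ, ‖w‖ < ‖z‖ → ‖g w‖ < s := by
  have hcl : IsClosed {z : ℂ | s ≤ ‖g z‖} :=
    isClosed_le continuous_const hg.continuous.norm
  have hne : {z : ℂ | s ≤ ‖g z‖}.Nonempty := by
    by_contra hcon
    rw [Set.not_nonempty_iff_eq_empty] at hcon
    apply ht
    apply poly_of_growth hg s 0
    intro R
    refine ⟨R, le_rfl, fun z _ => ?_⟩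
    have : z ∉ {z : ℂ | s ≤ ‖g z‖} := by rw [hcon]; simp
    simp only [mem_setOf_eq, not_le] at this
    simpa using this.le
  obtain ⟨z, hz, hd⟩ := hcl.exists_infDist_eq_dist hne 0
  refine ⟨z, hz, ?_⟩
  intro w hw
  by_contra hcon
  have : infDist 0 {z : ℂ | s ≤ ‖g z‖} ≤ dist 0 w := infDist_le_dist_of_mem (not_lt.1 hcon)
  rw [hd, dist_zero_left, dist_zero_left] at this
  linarith

lemma real_case {f g : ℂ → ℂ} (hf : Differentiable ℂ f) (hg : Differentiable ℂ g)
    (hft : ¬ ∃ p : Polynomial ℂ, ∀ z : ℂ, f z = p.eval z)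
    (hgt : ¬ ∃ p : Polynomial ℂ, ∀ z : ℂ, g z = p.eval z) (R₀ : ℝ)
    (hfix : ∀ z : ℂ, f (g z) = z → z.im ≠ 0 → ‖z‖ ≤ R₀) : False := by
  have hB : ∀ n : ℕ, ∃ w : ℂ, (n : ℝ) + 1 ≤ ‖w‖ ∧ ‖f w‖ ≤ 1 := fun n => small_values hf hft _
  choose b hb1 hb2 using hB
  have hZ : ∀ n : ℕ, ∃ z : ℂ, ‖b n‖ ≤ ‖g z‖ ∧ ∀ w : ℂ, ‖w‖ < ‖z‖ → ‖g w‖ < ‖b n‖ :=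
    fun n => first_hit hg hgt _
  choose ζ hζ1 hζ2 using hZ
  set s : ℕ → ℝ := fun n => ‖b n‖ with hs
  set r : ℕ → ℝ := fun n => ‖ζ n‖ with hr
  have hs0 : ∀ n, 0 < s n := fun n => lt_of_lt_of_le (by positivity) (hb1 n)
  have hst : Tendsto s atTop atTop := by
    apply tendsto_atTop_mono (f := fun n : ℕ => (n : ℝ)) _ tendsto_natCast_atTop_atTop
    intro n; have := hb1 n; simp only [hs]; linarith
  have hrt : Tendsto r atTop atTop := by
    rw [Filter.tendsto_atTop]
    intro R
    obtain ⟨M, hM⟩ := (isCompact_closedBall (0 : ℂ) R).exists_bound_of_continuousOn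
      hg.continuous.continuousOn
    filter_upwards [hst.eventually_gt_atTop M] with n hn
    by_contra hcon
    have h1 := hM (ζ n) (by simpa using (not_le.1 hcon).le)
    have h2 := hζ1 n
    simp only [hs] at hn
    linarith
  have hrs : ∀ᶠ n in atTop, r n ≤ s n := by
    by_contra hcon
    rw [not_eventually] at hcon
    apply hgt
    apply poly_of_growth hg 1 1
    intro R
    obtain ⟨n, hn, hn2⟩ := (hcon.and_eventually (hst.eventually_ge_atTop R)).exists
    refine ⟨s n, hn2, fun z hz => ?_⟩
    have := hζ2 n z (by rw [hz]; exact not_le.1 hn)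
    simp only [one_mul, pow_one]
    exact this.le
  have hr0 : ∀ᶠ n in atTop, 1 ≤ r n := hrt.eventually_ge_atTop 1
  have hl : ((hyperfilter ℕ : Ultrafilter ℕ) : Filter ℕ) ≤ atTop := by
    rw [← Nat.cofinite_eq_atTop]; exact hyperfilter_le_cofinite
  have hsc : ∀ n (z : ℂ), (s n : ℂ) * (z / s n) = z := by
    intro n z
    have : (s n : ℂ) ≠ 0 := by exact_mod_cast (hs0 n).ne'
    field_simp
  apply core (l := hyperfilter ℕ) (f := fun n w => f (s n * w) / r n)
    (g := fun n z => g (r n * z) / s n)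
  · intro n
    exact (hf.comp (by fun_prop : Differentiable ℂ fun w : ℂ => (s n : ℂ) * w)).div_const _
  · intro n
    exact (hg.comp (by fun_prop : Differentiable ℂ fun w : ℂ => (r n : ℂ) * w)).div_const _
  · apply Eventually.filter_mono hl
    filter_upwards [hr0] with n hn z hz
    rw [norm_div, Complex.norm_real, Real.norm_of_nonneg (hs0 n).le, div_le_one (hs0 n)]
    apply (hζ2 n _ _).le
    rw [norm_mul, Complex.norm_real, Real.norm_of_nonneg (by linarith)]
    have : r n * ‖z‖ < r n * 1 := by gcongr
    simpa using this
  · intro ρ hρ C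
    apply Eventually.filter_mono hl
    obtain ⟨R, hR⟩ := growth_ratio hg hgt hρ (lt_of_lt_of_le one_pos (le_max_right C 1))
    filter_upwards [hr0, hrt.eventually_ge_atTop R] with n hn hn2
    obtain ⟨z, hz, hz2⟩ := hR (r n) hn2 (s n) (hs0 n) ⟨ζ n, le_rfl, hζ1 n⟩
    have hrn : (0 : ℝ) < r n := by linarith
    have hrn' : (r n : ℂ) ≠ 0 := by exact_mod_cast hrn.ne'
    refine ⟨z / r n, ?_, ?_⟩
    · rw [norm_div, Complex.norm_real, Real.norm_of_nonneg hrn.le, div_le_iff₀ hrn]; exact hz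
    · rw [mul_div_cancel₀ _ hrn', norm_div, Complex.norm_real, Real.norm_of_nonneg (hs0 n).le,
        lt_div_iff₀ (hs0 n)]
      refine lt_of_le_of_lt ?_ hz2
      have := hs0 n
      gcongr
      exact le_max_left _ _
  · apply Eventually.filter_mono hl
    filter_upwards [hr0, hrt.eventually_ge_atTop ‖f 0‖] with n hn hn2
    rw [mul_zero, norm_div, Complex.norm_real, Real.norm_of_nonneg (by linarith),
      div_le_one (by linarith)]
    exact hn2
  · apply Eventually.filter_mono hl
    filter_upwards [hr0] with n hn
    refine ⟨b n / s n, ?_, ?_⟩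
    · rw [norm_div, Complex.norm_real, Real.norm_of_nonneg (hs0 n).le]
      exact div_self (hs0 n).ne'
    · rw [hsc, norm_div, Complex.norm_real, Real.norm_of_nonneg (by linarith),
        div_le_one (by linarith)]
      linarith [hb2 n]
  · intro δ hδ C
    apply Eventually.filter_mono hl
    by_contra hcon
    rw [not_eventually] at hcon
    apply hft
    apply poly_of_growth hf (|C| / δ) 1
    intro R
    obtain ⟨n, hn, hn2, hn3, hn4⟩ := (hcon.and_eventually
      ((hst.eventually_ge_atTop (R / δ)).and (hrs.and hr0))).exists
    refine ⟨δ * s n, by rw [ge_iff_le, ← div_le_iff₀' hδ]; exact hn2, fun z hz => ?_⟩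
    push Not at hn
    have hrn : (0 : ℝ) < r n := by linarith
    have := hn (z / s n) (by
      rw [norm_div, Complex.norm_real, Real.norm_of_nonneg (hs0 n).le, hz,
        mul_div_cancel_right₀ _ (hs0 n).ne'])
    rw [hsc, norm_div, Complex.norm_real, Real.norm_of_nonneg hrn.le, div_le_iff₀ hrn] at this
    calc ‖f z‖ ≤ C * r n := this
      _ ≤ |C| * s n := by gcongr; exact le_abs_self C
      _ = _ := by field_simp
  · apply Eventually.filter_mono hl
    filter_upwards [hr0, hrt.eventually_gt_atTop (2 * R₀)] with n hn hn2 z hz hfz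
    have hrn : (0 : ℝ) < r n := by linarith
    have hrn' : (r n : ℂ) ≠ 0 := by exact_mod_cast hrn.ne'
    rw [hsc, div_eq_iff hrn', mul_comm] at hfz
    by_contra him
    have := hfix (r n * z) (by rw [mul_comm z] at hfz; exact hfz) (by
      rw [Complex.im_ofReal_mul]; exact mul_ne_zero hrn.ne' him)
    rw [norm_mul, Complex.norm_real, Real.norm_of_nonneg hrn.le] at this
    nlinarith

end

/-- If `f` and `g` are transcendental entire functions and `L = {a + t b : t ∈ ℝ}`
is any straight line in the plane, then `f ∘ g` has infinitely many fixed points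
not lying on `L`. -/
theorem composite_entire_infinitely_many_fixed_points_off_line
    (f g : ℂ → ℂ)
    (hf : Differentiable ℂ f) (hg : Differentiable ℂ g)
    (hf_transc : ¬ ∃ p : Polynomial ℂ, ∀ z : ℂ, f z = p.eval z)
    (hg_transc : ¬ ∃ p : Polynomial ℂ, ∀ z : ℂ, g z = p.eval z)
    (a b : ℂ) (hb : b ≠ 0) :
    {z : ℂ | f (g z) = z ∧ z ∉ {w : ℂ | ∃ t : ℝ, w = a + (t : ℂ) * b}}.Infinite := by
  intro hfin
  obtain ⟨R, hR⟩ := hfin.isBounded.exists_norm_le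
  refine real_case (f := fun w => (f w - a) / b) (g := fun z => g (a + b * z))
    ((hf.sub_const a).div_const b)
    (hg.comp (by fun_prop : Differentiable ℂ fun z : ℂ => a + b * z)) ?_ ?_ ((R + ‖a‖) / ‖b‖) ?_
  · rintro ⟨p, hp⟩
    apply hf_transc
    refine ⟨Polynomial.C a + Polynomial.C b * p, fun z => ?_⟩
    have := hp z
    rw [div_eq_iff hb] at this
    simp only [Polynomial.eval_add, Polynomial.eval_mul, Polynomial.eval_C]
    linear_combination this
  · rintro ⟨p, hp⟩
    apply hg_transc
    refine ⟨p.comp (Polynomial.C b⁻¹ * (Polynomial.X - Polynomial.C a)), fun z => ?_⟩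
    have := hp (b⁻¹ * (z - a))
    simp only [Polynomial.eval_comp, Polynomial.eval_mul, Polynomial.eval_C, Polynomial.eval_sub,
      Polynomial.eval_X]
    rw [← this, mul_inv_cancel_left₀ hb]
    congr 1; ring
  · intro z hz him
    rw [div_eq_iff hb] at hz
    have h1 := hR (a + b * z) ⟨by linear_combination hz, by
      rintro ⟨t, ht⟩
      apply him
      have : z = t := by
        apply mul_left_cancel₀ hb
        linear_combination ht
      rw [this, Complex.ofReal_im]⟩
    rw [le_div_iff₀ (norm_pos_iff.2 hb), mul_comm, ← norm_mul]
    have h2 := norm_sub_le (a + b * z) a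
    rw [add_sub_cancel_left] at h2
    linarith
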